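/- There exists a universal constant C > 0 such that for any α, ε, δ ∈ (0,1) and k ∈ ℕ, there exists an (ε, δ)-differentially private algorithm that, given n i.i.d. samples from any mixture D of at most k univariate Gaussians with nonzero variances, where n ≥ C · L^C · ( k/α² + k·log(1/δ)/(αε) ) with L = log(2 + k/(αεδ)), outputs with probability at least 2/3 (over the samples and the algorithm's internal randomness) a mixture D̃ of at most k univariate Gaussians with TV(D̃, D) ≤ α. -/

import Mathlib

open MeasureTheory ProbabilityTheory Matrix Real
open scoped ENNReal

noncomputable section

/-- The univariate Gaussian measure `N(μ, σ²)` on `ℝ`. -/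
def gauss1 (μ σ : ℝ) : Measure ℝ :=
  volume.withDensity fun x =>
    ENNReal.ofReal ((Real.sqrt (2 * Real.pi * σ ^ 2))⁻¹ * Real.exp (-(x - μ) ^ 2 / (2 * σ ^ 2)))

/-- A mixture of `k` univariate Gaussians. -/
def mixture1 (k : ℕ) (w μ σ : Fin k → ℝ) : Measure ℝ :=
  Measure.sum fun i => ENNReal.ofReal (w i) • gauss1 (μ i) (σ i)

/-- Valid univariate GMM parameters. -/
def IsMixParams1 {k : ℕ} (w σ : Fin k → ℝ) : Prop :=
  (∀ i, 0 ≤ w i) ∧ (∑ i, w i = 1) ∧ ∀ i, 0 < σ i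

/-- Total variation distance between two measures. -/
def TV {E : Type*} [MeasurableSpace E] (P Q : Measure E) : ℝ :=
  ⨆ A : {s : Set E // MeasurableSet s}, |(P A.1).toReal - (Q A.1).toReal|

/-- Two datasets are adjacent if they differ in at most one entry. -/
def Adjacent {n : ℕ} {E : Type*} (X X' : Fin n → E) : Prop :=
  ∃ i : Fin n, ∀ j : Fin n, j ≠ i → X j = X' j

/-- `(ε, δ)`-differential privacy of a Markov kernel from datasets to outputs. -/
def IsDP {n : ℕ} {E Ω : Type*} [MeasurableSpace E] [MeasurableSpace Ω]
    (K : Kernel (Fin n → E) Ω) (ε δ : ℝ) : Prop :=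
  ∀ X X' : Fin n → E, Adjacent X X' → ∀ O : Set Ω, MeasurableSet O →
    K X' O ≤ ENNReal.ofReal (Real.exp ε) * K X O + ENNReal.ofReal δ

open Classical in
/-- Expectation of `φ` over a random subset of `S` containing each `b` independently w.p. `p b`. -/
def subE {B : Type*} (S : Finset B) (p : B → ℝ) (φ : Finset B → ℝ) : ℝ :=
  ∑ R ∈ S.powerset, (∏ b ∈ S, if b ∈ R then p b else 1 - p b) * φ R

open Classical in
lemma subE_insert {B : Type*} (S : Finset B) (b : B) (hb : b ∉ S) (p : B → ℝ) (φ : Finset B → ℝ) :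
    subE (insert b S) p φ = subE S p (fun R => p b * φ (insert b R) + (1 - p b) * φ R) := by
  unfold subE
  rw [Finset.sum_powerset_insert hb, ← Finset.sum_add_distrib]
  apply Finset.sum_congr rfl
  intro R hR
  have hbR : b ∉ R := fun h => hb (Finset.mem_powerset.1 hR h)
  rw [Finset.prod_insert hb, Finset.prod_insert hb]
  have e : ∏ x ∈ S, (if x ∈ insert b R then p x else 1 - p x)
      = ∏ x ∈ S, (if x ∈ R then p x else 1 - p x) := by
    apply Finset.prod_congr rfl
    intro x hx
    have : x ≠ b := fun h => hb (h ▸ hx)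
    simp [this]
  rw [e]
  simp [hbR]
  ring

lemma subE_empty {B : Type*} (p : B → ℝ) (φ : Finset B → ℝ) : subE ∅ p φ = φ ∅ := by
  simp [subE]

open Classical in
lemma subE_superset {B : Type*} (S S' : Finset B) (p : B → ℝ) (φ : Finset B → ℝ)
    (h : ∀ b, b ∉ S → p b = 0) : subE (S' ∪ S) p φ = subE S p φ := by
  induction S' using Finset.induction_on with
  | empty => simp
  | insert b S' hb ih =>
    by_cases hbS : b ∈ S' ∪ S
    · rw [Finset.insert_union, Finset.insert_eq_of_mem hbS, ih]
    · rw [Finset.insert_union, subE_insert _ _ hbS, ← ih, h b (by simp at hbS; tauto)]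
      simp

lemma subE_linear {B : Type*} (S : Finset B) (p : B → ℝ) (φ : Finset B → ℝ) (a c : ℝ) :
    subE S p (fun R => a * φ R + c) = a * subE S p φ + c := by
  classical
  induction S using Finset.induction_on generalizing φ with
  | empty => simp [subE_empty]
  | insert b S hb ih =>
    rw [subE_insert _ _ hb, subE_insert _ _ hb, ← ih]
    congr 1
    ext R
    ring

lemma subE_one {B : Type*} (S : Finset B) (p : B → ℝ) : subE S p (fun _ => 1) = 1 := by
  have := subE_linear S p (fun _ => 0) 0 1
  simpa using this

lemma subE_w_nonneg {B : Type*} [DecidableEq B] (S R : Finset B) (p : B → ℝ)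
    (h0 : ∀ b, 0 ≤ p b) (h1 : ∀ b, p b ≤ 1) :
    0 ≤ ∏ b ∈ S, (if b ∈ R then p b else 1 - p b) := by
  apply Finset.prod_nonneg
  intro b _
  split_ifs
  · exact h0 b
  · linarith [h1 b]

lemma subE_mono {B : Type*} (S : Finset B) (p : B → ℝ) (φ ψ : Finset B → ℝ)
    (h0 : ∀ b, 0 ≤ p b) (h1 : ∀ b, p b ≤ 1) (h : ∀ R, φ R ≤ ψ R) :
    subE S p φ ≤ subE S p ψ := by
  classical
  unfold subE
  apply Finset.sum_le_sum
  intro R _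
  exact mul_le_mul_of_nonneg_left (h R) (by convert subE_w_nonneg S R p h0 h1)

open Classical in
lemma subE_close {B : Type*} (S F : Finset B) (p p' : B → ℝ)
    (h0 : ∀ b, 0 ≤ p b) (h1 : ∀ b, p b ≤ 1) (h0' : ∀ b, 0 ≤ p' b) (h1' : ∀ b, p' b ≤ 1)
    (e d : ℝ) (he : 0 ≤ e) (hd : 0 ≤ d)
    (hF : ∀ b, b ∉ F → p b = p' b)
    (hc : ∀ b, p b ≤ exp e * p' b + d) (hc' : ∀ b, 1 - p b ≤ exp e * (1 - p' b) + d)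
    (φ : Finset B → ℝ) (hφ0 : ∀ R, 0 ≤ φ R) (hφ1 : ∀ R, φ R ≤ 1) :
    subE S p φ ≤ exp ((F ∩ S).card * e) * subE S p' φ +
      (F ∩ S).card * exp ((F ∩ S).card * e) * (2 * d) := by
  induction S using Finset.induction_on generalizing φ with
  | empty => simp [subE_empty]
  | insert b S hb ih =>
    rw [subE_insert _ _ hb, subE_insert _ _ hb]
    have ihb := ih (fun R => p b * φ (insert b R) + (1 - p b) * φ R)
      (fun R => add_nonneg (mul_nonneg (h0 b) (hφ0 _)) (mul_nonneg (by linarith [h1 b]) (hφ0 _)))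
      (fun R => by nlinarith [h0 b, h1 b, hφ1 R, hφ1 (insert b R)])
    by_cases hbF : b ∈ F
    · have hcard : (F ∩ insert b S).card = (F ∩ S).card + 1 := by
        rw [Finset.inter_insert_of_mem hbF, Finset.card_insert_of_notMem]
        simp [hb]
      rw [hcard]
      set m := (F ∩ S).card
      have key : subE S p' (fun R => p b * φ (insert b R) + (1 - p b) * φ R) ≤
          exp e * subE S p' (fun R => p' b * φ (insert b R) + (1 - p' b) * φ R) + 2 * d := by
        rw [← subE_linear]
        apply subE_mono _ _ _ _ h0' h1'
        intro R
        have a1 := mul_le_mul_of_nonneg_right (hc b) (hφ0 (insert b R))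
        have a2 := mul_le_mul_of_nonneg_right (hc' b) (hφ0 R)
        nlinarith [hφ1 R, hφ1 (insert b R)]
      set Y := subE S p' (fun R => p' b * φ (insert b R) + (1 - p' b) * φ R)
      set X := subE S p' (fun R => p b * φ (insert b R) + (1 - p b) * φ R)
      have hexp : exp (((m + 1 : ℕ) : ℝ) * e) = exp (m * e) * exp e := by
        rw [← exp_add]; push_cast; ring_nf
      rw [hexp]
      have hpos := exp_pos (m * e)
      have he1 : 1 ≤ exp e := one_le_exp he
      have k1 := mul_le_mul_of_nonneg_left key hpos.le
      push_cast
      have k2 : ((m:ℝ) + 1) * exp (m * e) * (2 * d) ≤ ((m:ℝ) + 1) * (exp (m * e) * exp e) * (2 * d) := by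
        apply mul_le_mul_of_nonneg_right _ (by linarith)
        apply mul_le_mul_of_nonneg_left _ (by positivity)
        nlinarith
      nlinarith
    · have hcard : F ∩ insert b S = F ∩ S := Finset.inter_insert_of_notMem hbF
      rw [hcard]
      rw [← hF b hbF]
      exact ihb

/-- Inclusion probability as a function of the count. -/
def incl (e : ℝ) (t c : ℕ) : ℝ :=
  if c = 0 then 0 else if 2 * t ≤ c then 1 else 1 / (1 + exp (e * (t - c)))

lemma incl_nonneg (e : ℝ) (t c : ℕ) : 0 ≤ incl e t c := by
  unfold incl; split_ifs <;> positivity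

lemma incl_le_one (e : ℝ) (t c : ℕ) : incl e t c ≤ 1 := by
  unfold incl; split_ifs
  · norm_num
  · norm_num
  · rw [div_le_one (by positivity)]
    linarith [exp_pos (e * (t - c))]

lemma logi_mid (e x y : ℝ) (he : 0 ≤ e) (h : y ≤ x + e) : 1 / (1 + exp x) ≤ exp e * (1 / (1 + exp y)) := by
  rw [mul_one_div, div_le_div_iff₀ (by positivity) (by positivity)]
  have h1 : exp y ≤ exp e * exp x := by rw [← exp_add]; exact exp_le_exp.2 (by linarith)
  have h2 := one_le_exp he
  nlinarith

lemma logi_compl (x : ℝ) : 1 - 1 / (1 + exp x) = 1 / (1 + exp (-x)) := by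
  rw [exp_neg]; have := exp_pos x; field_simp; ring

lemma logi_small (x d : ℝ) (h : exp (-x) ≤ d) : 1 / (1 + exp x) ≤ d := by
  refine le_trans ?_ h
  rw [exp_neg, one_div]
  apply inv_anti₀ (exp_pos x); linarith

lemma incl_close (e d : ℝ) (he : 0 ≤ e) (hd : 0 ≤ d) (t c c' : ℕ) (ht : 1 ≤ t)
    (htd : exp (-(e * (t - 1))) ≤ d) (h : c ≤ c' + 1) (h' : c' ≤ c + 1) :
    incl e t c ≤ exp e * incl e t c' + d ∧ 1 - incl e t c ≤ exp e * (1 - incl e t c') + d := by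
  have he1 : 1 ≤ exp e := one_le_exp he
  have triv : ∀ a b : ℝ, 0 ≤ b → a ≤ b → a ≤ exp e * b + d := fun a b hb hab => by nlinarith
  have A0 := incl_nonneg e t c
  have A1 := incl_le_one e t c
  have A0' := incl_nonneg e t c'
  have A1' := incl_le_one e t c'
  by_cases hcc : c = c'
  · subst hcc; exact ⟨triv _ _ A0 le_rfl, triv _ _ (by linarith) le_rfl⟩
  -- smallness facts
  have s1 : incl e t 1 ≤ d := by
    unfold incl; rw [if_neg one_ne_zero, if_neg (by omega)]
    exact logi_small _ _ (by simpa using htd)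
  have s2 : 1 - incl e t (2*t-1) ≤ d := by
    unfold incl; rw [if_neg (by omega), if_neg (by omega), logi_compl]
    refine logi_small _ _ (le_trans (le_of_eq ?_) htd)
    congr 1
    rw [Nat.cast_sub (by omega)]; push_cast; ring
  have i0 : incl e t 0 = 0 := by simp [incl]
  have i2 : ∀ c, 2 * t ≤ c → incl e t c = 1 := fun c hc => by
    unfold incl; rw [if_neg (by omega), if_pos hc]
  by_cases c0 : c = 0
  · obtain rfl : c' = 1 := by omega
    subst c0; rw [i0]
    refine ⟨by positivity, by nlinarith⟩
  by_cases c0' : c' = 0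
  · obtain rfl : c = 1 := by omega
    subst c0'; rw [i0]
    refine ⟨by linarith, by linarith⟩
  by_cases c2 : 2 * t ≤ c
  · rw [i2 c c2]
    by_cases c2' : 2 * t ≤ c'
    · rw [i2 c' c2']; constructor <;> nlinarith
    · obtain rfl : c' = 2*t-1 := by omega
      constructor <;> nlinarith
  by_cases c2' : 2 * t ≤ c'
  · rw [i2 c' c2']
    obtain rfl : c = 2*t-1 := by omega
    constructor <;> nlinarith
  unfold incl
  rw [if_neg c0, if_neg c2, if_neg c0', if_neg c2']
  have hr : (c:ℝ) ≤ c' + 1 := by exact_mod_cast h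
  have hr' : (c':ℝ) ≤ c + 1 := by exact_mod_cast h'
  constructor
  · have := logi_mid e (e * (t - c)) (e * (t - c')) he (by nlinarith)
    linarith
  · rw [logi_compl, logi_compl]
    have := logi_mid e (-(e * (t - c))) (-(e * (t - c'))) he (by nlinarith)
    linarith


/-- Consecutive sample values. -/
def consec {N : ℕ} (x : Fin N → ℝ) (j l : Fin N) : Prop :=
  x j < x l ∧ ∀ m, ¬ (x j < x m ∧ x m < x l)

/-- The bin of a gap: scale and coarse location. -/
def binOf (N : ℕ) (u v : ℝ) : ℤ × ℤ :=
  (⌊Real.logb 2 (v - u)⌋, ⌊u / (4 * N * (2:ℝ) ^ ⌊Real.logb 2 (v - u)⌋)⌋)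

open Classical in
/-- The bins voted for by a group of samples. -/
def votes {N : ℕ} (x : Fin N → ℝ) : Finset (ℤ × ℤ) :=
  ((Finset.univ : Finset (Fin N × Fin N)).filter (fun q => consec x q.1 q.2)).image
    (fun q => binOf N (x q.1) (x q.2))

lemma mem_votes {N : ℕ} (x : Fin N → ℝ) (b : ℤ × ℤ) :
    b ∈ votes x ↔ ∃ j l, consec x j l ∧ binOf N (x j) (x l) = b := by
  simp [votes]

open Classical in
lemma card_votes {N : ℕ} (x : Fin N → ℝ) : (votes x).card ≤ N * N := by
  unfold votes
  refine le_trans Finset.card_image_le (le_trans (Finset.card_filter_le _ _) ?_)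
  simp

open Classical in
lemma votes_diff {N : ℕ} (x x' : Fin N → ℝ) (i : Fin N) (h : ∀ j, j ≠ i → x j = x' j) :
    (votes x \ votes x').card ≤ 3 := by
  set D1 := (votes x).filter (fun b => ∃ j l, consec x j l ∧ binOf N (x j) (x l) = b ∧ x j = x i)
  set D2 := (votes x).filter (fun b => ∃ j l, consec x j l ∧ binOf N (x j) (x l) = b ∧ x l = x i)
  set D3 := (votes x).filter (fun b => ∃ j l, consec x j l ∧ binOf N (x j) (x l) = b ∧
    x j < x' i ∧ x' i < x l)
  have hsub : votes x \ votes x' ⊆ D1 ∪ D2 ∪ D3 := by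
    intro b hb
    rw [Finset.mem_sdiff] at hb
    obtain ⟨hb1, hb2⟩ := hb
    obtain ⟨j, l, hc, hbin⟩ := (mem_votes x b).1 hb1
    by_cases e1 : x j = x i
    · simp only [Finset.mem_union, D1, Finset.mem_filter]
      exact Or.inl (Or.inl ⟨hb1, j, l, hc, hbin, e1⟩)
    by_cases e2 : x l = x i
    · simp only [Finset.mem_union, D2, Finset.mem_filter]
      exact Or.inl (Or.inr ⟨hb1, j, l, hc, hbin, e2⟩)
    by_cases e3 : x j < x' i ∧ x' i < x l
    · simp only [Finset.mem_union, D3, Finset.mem_filter]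
      exact Or.inr ⟨hb1, j, l, hc, hbin, e3⟩
    exfalso
    apply hb2
    have hj : x j = x' j := h j (fun hh => e1 (by rw [hh]))
    have hl : x l = x' l := h l (fun hh => e2 (by rw [hh]))
    rw [mem_votes]
    refine ⟨j, l, ⟨by rw [← hj, ← hl]; exact hc.1, ?_⟩, by rw [← hj, ← hl]; exact hbin⟩
    intro m
    rw [← hj, ← hl]
    by_cases hm : m = i
    · rw [hm]; exact e3
    · rw [← h m hm]; exact hc.2 m
  have c1 : D1.card ≤ 1 := by
    rw [Finset.card_le_one]
    intro b hb b' hb'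
    simp only [D1, Finset.mem_filter] at hb hb'
    obtain ⟨-, j, l, hc, rfl, e⟩ := hb
    obtain ⟨-, j', l', hc', rfl, e'⟩ := hb'
    have a1 := hc.2 l'; have a2 := hc'.2 l
    have a3 := hc.1; have a4 := hc'.1
    rw [e] at a1 a3 ⊢; rw [e'] at a2 a4 ⊢
    have : x l = x l' := by
      apply le_antisymm
      · by_contra hh; exact a1 ⟨a4, not_le.1 hh⟩
      · by_contra hh; exact a2 ⟨a3, not_le.1 hh⟩
    rw [this]
  have c2 : D2.card ≤ 1 := by
    rw [Finset.card_le_one]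
    intro b hb b' hb'
    simp only [D2, Finset.mem_filter] at hb hb'
    obtain ⟨-, j, l, hc, rfl, e⟩ := hb
    obtain ⟨-, j', l', hc', rfl, e'⟩ := hb'
    have a1 := hc.2 j'; have a2 := hc'.2 j
    have a3 := hc.1; have a4 := hc'.1
    rw [e] at a1 a3 ⊢; rw [e'] at a2 a4 ⊢
    have : x j = x j' := by
      apply le_antisymm
      · by_contra hh; exact a2 ⟨not_le.1 hh, a3⟩
      · by_contra hh; exact a1 ⟨not_le.1 hh, a4⟩
    rw [this]
  have c3 : D3.card ≤ 1 := by
    rw [Finset.card_le_one]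
    intro b hb b' hb'
    simp only [D3, Finset.mem_filter] at hb hb'
    obtain ⟨-, j, l, hc, rfl, e, f⟩ := hb
    obtain ⟨-, j', l', hc', rfl, e', f'⟩ := hb'
    have : x j = x j' := by
      apply le_antisymm
      · by_contra hh; exact hc'.2 j ⟨not_le.1 hh, by linarith⟩
      · by_contra hh; exact hc.2 j' ⟨not_le.1 hh, by linarith⟩
    have h2 : x l = x l' := by
      apply le_antisymm
      · by_contra hh; exact hc.2 l' ⟨by linarith, not_le.1 hh⟩
      · by_contra hh; exact hc'.2 l ⟨by linarith, not_le.1 hh⟩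
    rw [this, h2]
  have u1 := Finset.card_union_le (D1 ∪ D2) D3
  have u2 := Finset.card_union_le D1 D2
  have u3 := Finset.card_le_card hsub
  omega

lemma measurable_binOf (N : ℕ) : Measurable (fun q : ℝ × ℝ => binOf N q.1 q.2) := by
  have h1 : Measurable (fun q : ℝ × ℝ => ⌊Real.logb 2 (q.2 - q.1)⌋) := by
    apply Measurable.floor
    unfold Real.logb
    exact (Real.measurable_log.comp (measurable_snd.sub measurable_fst)).div_const _
  have h2 : Measurable (fun q : ℝ × ℝ => (2:ℝ) ^ ⌊Real.logb 2 (q.2 - q.1)⌋) :=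
    (measurable_of_countable (fun s : ℤ => (2:ℝ) ^ s)).comp h1
  unfold binOf
  refine h1.prodMk ?_
  apply Measurable.floor
  exact measurable_fst.div (h2.const_mul _)

lemma measurable_mem_votes {N : ℕ} (b : ℤ × ℤ) : MeasurableSet {x : Fin N → ℝ | b ∈ votes x} := by
  have : {x : Fin N → ℝ | b ∈ votes x} = ⋃ j, ⋃ l, ({x : Fin N → ℝ | x j < x l} ∩
      ⋂ m, ({x : Fin N → ℝ | x j < x m} ∩ {x | x m < x l})ᶜ) ∩
      {x | binOf N (x j) (x l) = b} := by
    ext x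
    simp only [Set.mem_ofPred_eq, mem_votes, Set.mem_iUnion, Set.mem_inter_iff, Set.mem_iInter,
      Set.mem_compl_iff, consec]
  rw [this]
  refine MeasurableSet.iUnion fun j => MeasurableSet.iUnion fun l => ?_
  refine MeasurableSet.inter (MeasurableSet.inter ?_ (MeasurableSet.iInter fun m => ?_)) ?_
  · exact measurableSet_lt (measurable_pi_apply j) (measurable_pi_apply l)
  · exact ((measurableSet_lt (measurable_pi_apply j) (measurable_pi_apply m)).inter
      (measurableSet_lt (measurable_pi_apply m) (measurable_pi_apply l))).compl
  · have hm : Measurable (fun x : Fin N → ℝ => binOf N (x j) (x l)) :=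
      (measurable_binOf N).comp (g := fun q : ℝ × ℝ => binOf N q.1 q.2)
        (f := fun x : Fin N → ℝ => (x j, x l))
        ((measurable_pi_apply j).prodMk (measurable_pi_apply l))
    exact hm (measurableSet_singleton b)

lemma exists_gap {N : ℕ} (x : Fin N → ℝ) (a : Fin N) (M : ℕ) : ∀ b, x a < x b →
    (Finset.univ.filter (fun m => x a < x m ∧ x m ≤ x b)).card ≤ M →
    ∃ j l, consec x j l ∧ x a ≤ x j ∧ x l ≤ x b ∧ x b - x a ≤ M * (x l - x j) := by
  induction M with
  | zero =>
    intro b hab hcard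
    exfalso
    have : b ∈ Finset.univ.filter (fun m => x a < x m ∧ x m ≤ x b) := by simp [hab]
    rw [Nat.le_zero, Finset.card_eq_zero] at hcard
    rw [hcard] at this
    simp at this
  | succ M ih =>
    intro b hab hcard
    obtain ⟨c, hc, hmax⟩ := Finset.exists_max_image (Finset.univ.filter (fun m => x m < x b)) x
      ⟨a, by simp [hab]⟩
    simp only [Finset.mem_filter, Finset.mem_univ, true_and] at hc hmax
    have hac : x a ≤ x c := hmax a hab
    have hcons : consec x c b := ⟨hc, fun m hm => absurd (hmax m hm.2) (not_le.2 hm.1)⟩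
    rcases hac.eq_or_lt with e | hlt
    · refine ⟨c, b, hcons, hac, le_rfl, ?_⟩
      push_cast
      have : (0:ℝ) ≤ M := Nat.cast_nonneg M
      nlinarith
    · have hsub : Finset.univ.filter (fun m => x a < x m ∧ x m ≤ x c) ⊂
          Finset.univ.filter (fun m => x a < x m ∧ x m ≤ x b) := by
        rw [Finset.ssubset_iff_of_subset]
        · exact ⟨b, by simp [hab], by simp [hc]⟩
        · intro m
          simp only [Finset.mem_filter, Finset.mem_univ, true_and]
          rintro ⟨h1, h2⟩; exact ⟨h1, by linarith⟩
      have hlt' := Finset.card_lt_card hsub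
      obtain ⟨j, l, h1, h2, h3, h4⟩ := ih c hlt (by omega)
      have hM : (0:ℝ) ≤ M := Nat.cast_nonneg M
      by_cases hg : x b - x c ≤ x l - x j
      · refine ⟨j, l, h1, h2, by linarith, ?_⟩
        push_cast; nlinarith
      · refine ⟨c, b, hcons, hac, le_rfl, ?_⟩
        push_cast; nlinarith

/-- The bin `b` is informative about the Gaussian `N(μ,σ²)`. -/
def GoodBin (N : ℕ) (μ σ : ℝ) (b : ℤ × ℤ) : Prop :=
  σ ≤ 2 * N * (2:ℝ) ^ b.1 ∧ (2:ℝ) ^ b.1 ≤ 2 * σ ∧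
    ∃ u, μ - σ ≤ u ∧ u ≤ μ + σ ∧ b.2 = ⌊u / (4 * N * (2:ℝ) ^ b.1)⌋

lemma exists_good_vote {N : ℕ} (x : Fin N → ℝ) (μ σ : ℝ) (hσ : 0 < σ) (a b : Fin N)
    (ha : μ - σ ≤ x a) (ha' : x a ≤ μ - σ / 2) (hb : μ + σ / 2 ≤ x b) (hb' : x b ≤ μ + σ) :
    ∃ v ∈ votes x, GoodBin N μ σ v := by
  obtain ⟨j, l, hc, h1, h2, h3⟩ := exists_gap x a N b (by linarith)
    (le_trans (Finset.card_filter_le _ _) (by simp))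
  refine ⟨binOf N (x j) (x l), (mem_votes _ _).2 ⟨j, l, hc, rfl⟩, ?_⟩
  have hg : 0 < x l - x j := by linarith [hc.1]
  have hlog : ⌊Real.logb 2 (x l - x j)⌋ = Int.log 2 (x l - x j) := by
    exact_mod_cast Real.floor_logb_natCast (b := 2) (r := x l - x j) hg.le
  have g1 : (2:ℝ) ^ ⌊Real.logb 2 (x l - x j)⌋ ≤ x l - x j := by
    rw [hlog]; exact_mod_cast Int.zpow_log_le_self (b := 2) (by norm_num) hg
  have g2 : x l - x j < 2 * (2:ℝ) ^ ⌊Real.logb 2 (x l - x j)⌋ := by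
    rw [hlog]
    have := Int.lt_zpow_succ_log_self (b := 2) (by norm_num) (x l - x j)
    rw [zpow_add_one₀ (by norm_num)] at this
    push_cast at this; linarith
  refine ⟨?_, ?_, x j, by linarith, by linarith [hc.1], rfl⟩
  · simp only [binOf]
    have hN : (0:ℝ) ≤ N := Nat.cast_nonneg N
    nlinarith
  · simp only [binOf]; linarith

open Classical in
lemma good_finite (N : ℕ) (hN : 1 ≤ N) (μ σ : ℝ) (hσ : 0 < σ) : ∃ G : Finset (ℤ × ℤ),
    G.card ≤ 2 * (Nat.clog 2 N + 3) ∧ ∀ b, GoodBin N μ σ b → b ∈ G := by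
  set r := Nat.clog 2 N
  set s0 := Int.log 2 (2 * σ)
  refine ⟨(Finset.Icc (s0 - (r + 2)) s0).biUnion (fun s =>
    {(s, ⌊(μ - σ) / (4 * N * (2:ℝ) ^ s)⌋), (s, ⌊(μ - σ) / (4 * N * (2:ℝ) ^ s)⌋ + 1)}), ?_, ?_⟩
  · refine le_trans (Finset.card_biUnion_le_card_mul _ _ 2 (fun s _ => Finset.card_le_two)) ?_
    rw [Int.card_Icc]
    have : (s0 + 1 - (s0 - (r + 2))).toNat = r + 3 := by omega
    rw [this]; omega
  · rintro ⟨s, ℓ⟩ ⟨h1, h2, u, hu1, hu2, hl⟩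
    simp only at h1 h2 hl
    have hN' : (1:ℝ) ≤ N := by exact_mod_cast hN
    have hs : (0:ℝ) < (2:ℝ) ^ s := by positivity
    have up : s ≤ s0 := by
      rw [← Int.zpow_le_iff_le_log (by norm_num) (by linarith)]
      exact_mod_cast h2
    have lo : s0 - (r + 2) ≤ s := by
      have a1 : (2:ℝ) ^ s0 ≤ 2 * σ := by
        exact_mod_cast Int.zpow_log_le_self (b := 2) (r := 2 * σ) (by norm_num) (by linarith)
      have a2 : (N:ℝ) ≤ 2 ^ r := by exact_mod_cast Nat.le_pow_clog (by norm_num) N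
      have a3 : (2:ℝ) ^ s0 ≤ (2:ℝ) ^ (s + (r + 2 : ℤ)) := by
        rw [zpow_add₀ (by norm_num), zpow_add₀ (by norm_num), zpow_natCast]
        norm_num
        nlinarith
      rw [zpow_le_zpow_iff_right₀ (by norm_num)] at a3
      linarith
    rw [Finset.mem_biUnion]
    refine ⟨s, Finset.mem_Icc.2 ⟨lo, up⟩, ?_⟩
    have hW : 0 < 4 * N * (2:ℝ) ^ s := by positivity
    have b1 : ⌊(μ - σ) / (4 * N * (2:ℝ) ^ s)⌋ ≤ ℓ := by
      rw [hl]; exact Int.floor_le_floor (div_le_div_of_nonneg_right hu1 hW.le)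
    have b2 : ℓ ≤ ⌊(μ - σ) / (4 * N * (2:ℝ) ^ s)⌋ + 1 := by
      rw [hl, ← Int.floor_add_one]
      apply Int.floor_le_floor
      rw [div_add_one hW.ne']
      apply div_le_div_of_nonneg_right _ hW.le
      linarith
    simp only [Finset.mem_insert, Finset.mem_singleton, Prod.mk.injEq, true_and]
    omega


lemma gauss1_prob (μ σ : ℝ) (hσ : 0 < σ) : IsProbabilityMeasure (gauss1 μ σ) := by
  have h : gauss1 μ σ = gaussianReal μ (Real.toNNReal (σ ^ 2)) := by
    rw [gaussianReal_of_var_ne_zero]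
    · unfold gauss1 gaussianPDF gaussianPDFReal
      rw [Real.coe_toNNReal _ (sq_nonneg σ)]
    · exact (Real.toNNReal_pos.2 (by positivity)).ne'
  rw [h]
  infer_instance

lemma gauss1_mass (μ σ a : ℝ) (hσ : 0 < σ) (h1 : μ - σ ≤ a) (h2 : a + σ / 2 ≤ μ + σ) :
    1 / 12 ≤ (gauss1 μ σ (Set.Icc a (a + σ / 2))).toReal := by
  have := gauss1_prob μ σ hσ
  rw [← ENNReal.ofReal_le_iff_le_toReal (measure_ne_top _ _)]
  unfold gauss1
  rw [withDensity_apply _ measurableSet_Icc]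
  have hlow : ∀ x ∈ Set.Icc a (a + σ / 2), ENNReal.ofReal (1 / (6 * σ)) ≤ ENNReal.ofReal
      ((Real.sqrt (2 * Real.pi * σ ^ 2))⁻¹ * Real.exp (-(x - μ) ^ 2 / (2 * σ ^ 2))) := by
    intro x hx
    apply ENNReal.ofReal_le_ofReal
    have e1 : Real.sqrt (2 * Real.pi * σ ^ 2) ≤ 3 * σ := by
      apply Real.sqrt_le_iff.2
      refine ⟨by positivity, ?_⟩
      nlinarith [Real.pi_lt_four, sq_nonneg σ]
    have e2 : (1:ℝ) / 2 ≤ Real.exp (-(x - μ) ^ 2 / (2 * σ ^ 2)) := by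
      refine le_trans ?_ (add_one_le_exp _)
      have : (x - μ) ^ 2 ≤ σ ^ 2 := by
        apply sq_le_sq'
        · linarith [hx.1]
        · linarith [hx.2]
      have : -(1/2) ≤ -(x - μ) ^ 2 / (2 * σ ^ 2) := by
        rw [le_div_iff₀ (by positivity)]
        linarith
      linarith
    have e3 : (3 * σ)⁻¹ ≤ (Real.sqrt (2 * Real.pi * σ ^ 2))⁻¹ :=
      inv_anti₀ (Real.sqrt_pos.2 (by positivity)) e1
    calc 1 / (6 * σ) = (3 * σ)⁻¹ * (1 / 2) := by field_simp; norm_num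
      _ ≤ _ := mul_le_mul e3 e2 (by norm_num) (by positivity)
  calc ENNReal.ofReal (1 / 12) = ∫⁻ _ in Set.Icc a (a + σ / 2), ENNReal.ofReal (1 / (6 * σ)) := by
        rw [setLIntegral_const, Real.volume_Icc, ← ENNReal.ofReal_mul (by positivity)]
        congr 1
        field_simp
        ring
    _ ≤ _ := setLIntegral_mono' measurableSet_Icc hlow

lemma gauss1_dom (μ σ μ' σ' κ : ℝ) (hσ : 0 < σ) (hκ : 0 < κ) (hκ1 : κ < 1)
    (h1 : σ * (1 + κ / 4) ≤ σ') (h2 : σ' ≤ σ * (1 + κ / 2)) (h3 : |μ - μ'| ≤ σ * κ / 4)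
    (A : Set ℝ) (hA : MeasurableSet A) :
    (gauss1 μ σ A).toReal - κ ≤ (gauss1 μ' σ' A).toReal := by
  have hσ' : 0 < σ' := lt_of_lt_of_le (by positivity) h1
  have := gauss1_prob μ σ hσ
  have := gauss1_prob μ' σ' hσ'
  have hdens : ∀ x, (1 - κ) * ((Real.sqrt (2 * Real.pi * σ ^ 2))⁻¹ *
      Real.exp (-(x - μ) ^ 2 / (2 * σ ^ 2))) ≤
      (Real.sqrt (2 * Real.pi * σ' ^ 2))⁻¹ * Real.exp (-(x - μ') ^ 2 / (2 * σ' ^ 2)) := by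
    intro x
    rw [Real.sqrt_mul (x := 2 * Real.pi) (by positivity) (σ ^ 2),
      Real.sqrt_mul (x := 2 * Real.pi) (by positivity) (σ' ^ 2), Real.sqrt_sq hσ.le,
      Real.sqrt_sq hσ'.le]
    have hs : 0 < Real.sqrt (2 * Real.pi) := Real.sqrt_pos.2 (by positivity)
    have hexp : Real.exp (-(κ / 16)) * Real.exp (-(x - μ) ^ 2 / (2 * σ ^ 2)) ≤
        Real.exp (-(x - μ') ^ 2 / (2 * σ' ^ 2)) := by
      rw [← exp_add]
      apply exp_le_exp.2
      have hm : (μ - μ') ^ 2 ≤ (σ * κ / 4) ^ 2 := by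
        rw [← sq_abs]; exact pow_le_pow_left₀ (abs_nonneg _) h3 2
      have hv : σ ^ 2 + σ ^ 2 * κ / 2 ≤ σ' ^ 2 := by nlinarith
      have hd : 0 < σ' ^ 2 - σ ^ 2 := by nlinarith [mul_pos (pow_pos hσ 2) hκ]
      have hd0 : σ ^ 2 * κ / 2 ≤ σ' ^ 2 - σ ^ 2 := by linarith
      set S := σ ^ 2 with hS
      set S' := σ' ^ 2 with hS'
      have hSp : 0 < S := by positivity
      have hSp' : 0 < S' := by positivity
      set y := x - μ with hy
      set d := μ - μ' with hdd
      have hx : x - μ' = y + d := by rw [hy, hdd]; ring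
      rw [hx]
      have hm' : d ^ 2 ≤ S * κ ^ 2 / 16 := by rw [hS]; nlinarith
      have hmm : d ^ 2 ≤ κ / 8 * (S' - S) := by nlinarith
      rw [← sub_nonneg]
      have : -(y + d) ^ 2 / (2 * S') - (-(κ / 16) + -y ^ 2 / (2 * S)) =
          ((κ / 8) * S * S' + S' * y ^ 2 - S * (y + d) ^ 2) / (2 * S * S') := by
        field_simp; ring
      rw [this]
      apply div_nonneg _ (by positivity)
      -- S' y² - S (y+d)² ≥ - S S' d²/(S'-S)
      have key : 0 ≤ (S' - S) * ((κ / 8) * S * S' + S' * y ^ 2 - S * (y + d) ^ 2) := by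
        have e : (S' - S) * ((κ / 8) * S * S' + S' * y ^ 2 - S * (y + d) ^ 2)
            = ((S' - S) * y - S * d) ^ 2 + S * S' * (κ / 8 * (S' - S) - d ^ 2) := by ring
        rw [e]
        have : 0 ≤ S * S' * (κ / 8 * (S' - S) - d ^ 2) := mul_nonneg (by positivity) (by linarith)
        positivity
      by_contra hneg
      push Not at hneg
      nlinarith
    have hexp2 : 1 - κ / 16 ≤ Real.exp (-(κ / 16)) := by linarith [add_one_le_exp (-(κ / 16))]
    have hinv : (1 - κ / 2) * σ⁻¹ ≤ σ'⁻¹ := by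
      rw [← div_eq_mul_inv, ← one_div, div_le_div_iff₀ hσ hσ']
      nlinarith
    set E := Real.exp (-(x - μ) ^ 2 / (2 * σ ^ 2)) with hE
    have hE0 : 0 < E := exp_pos _
    set s := Real.sqrt (2 * Real.pi)
    have hk : (1 - κ) ≤ (1 - κ / 2) * (1 - κ / 16) := by nlinarith
    calc (1 - κ) * ((s * σ)⁻¹ * E) ≤ ((1 - κ / 2) * (1 - κ / 16)) * ((s * σ)⁻¹ * E) :=
          mul_le_mul_of_nonneg_right hk (by positivity)
      _ = s⁻¹ * (((1 - κ / 2) * σ⁻¹) * ((1 - κ / 16) * E)) := by rw [mul_inv]; ring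
      _ ≤ s⁻¹ * (σ'⁻¹ * (Real.exp (-(κ / 16)) * E)) := by
          apply mul_le_mul_of_nonneg_left _ (by positivity)
          apply mul_le_mul hinv _ _ (by positivity)
          · exact mul_le_mul_of_nonneg_right hexp2 hE0.le
          · apply mul_nonneg _ hE0.le; linarith
      _ ≤ s⁻¹ * (σ'⁻¹ * Real.exp (-(x - μ') ^ 2 / (2 * σ' ^ 2))) := by
          apply mul_le_mul_of_nonneg_left _ (by positivity)
          exact mul_le_mul_of_nonneg_left hexp (by positivity)
      _ = _ := by rw [mul_inv]; ring
  have hmeas : ENNReal.ofReal (1 - κ) * gauss1 μ σ A ≤ gauss1 μ' σ' A := by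
    unfold gauss1
    rw [withDensity_apply _ hA, withDensity_apply _ hA, ← lintegral_const_mul' _ _ ENNReal.ofReal_ne_top]
    apply lintegral_mono
    intro x
    simp only
    rw [← ENNReal.ofReal_mul (by linarith)]
    exact ENNReal.ofReal_le_ofReal (hdens x)
  have h := ENNReal.toReal_mono (measure_ne_top _ _) hmeas
  rw [ENNReal.toReal_mul, ENNReal.toReal_ofReal (by linarith)] at h
  have h1 : (gauss1 μ σ A).toReal ≤ 1 := by
    have := prob_le_one (μ := gauss1 μ σ) (s := A)
    exact ENNReal.toReal_le_of_le_ofReal (by norm_num) (by simpa using this)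
  nlinarith

lemma mixture1_toReal {k : ℕ} (w μ σ : Fin k → ℝ) (h : IsMixParams1 w σ) (A : Set ℝ)
    (hA : MeasurableSet A) :
    (mixture1 k w μ σ A).toReal = ∑ i, w i * (gauss1 (μ i) (σ i) A).toReal := by
  unfold mixture1
  have : ∀ i, IsProbabilityMeasure (gauss1 (μ i) (σ i)) := fun i => gauss1_prob _ _ (h.2.2 i)
  rw [Measure.sum_apply _ hA, tsum_fintype, ENNReal.toReal_sum]
  · apply Finset.sum_congr rfl
    intro i _
    rw [Measure.smul_apply, smul_eq_mul, ENNReal.toReal_mul, ENNReal.toReal_ofReal (h.1 i)]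
  · intro i _
    rw [Measure.smul_apply, smul_eq_mul]
    exact ENNReal.mul_ne_top ENNReal.ofReal_ne_top (measure_ne_top _ _)

lemma mixture1_prob {k : ℕ} (w μ σ : Fin k → ℝ) (h : IsMixParams1 w σ) :
    IsProbabilityMeasure (mixture1 k w μ σ) := by
  constructor
  have : ∀ i, IsProbabilityMeasure (gauss1 (μ i) (σ i)) := fun i => gauss1_prob _ _ (h.2.2 i)
  unfold mixture1
  rw [Measure.sum_apply _ MeasurableSet.univ, tsum_fintype]
  simp only [Measure.smul_apply, measure_univ, smul_eq_mul, mul_one]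
  rw [← ENNReal.ofReal_sum_of_nonneg (fun i _ => h.1 i), h.2.1, ENNReal.ofReal_one]

lemma prob_toReal_le_one {E : Type*} [MeasurableSpace E] (P : Measure E) [IsProbabilityMeasure P]
    (A : Set E) : (P A).toReal ≤ 1 :=
  ENNReal.toReal_le_of_le_ofReal (by norm_num) (by simpa using prob_le_one (μ := P) (s := A))

lemma TV_bdd {E : Type*} [MeasurableSpace E] (P Q : Measure E) [IsProbabilityMeasure P]
    [IsProbabilityMeasure Q] : BddAbove (Set.range fun A : {s : Set E // MeasurableSet s} =>
      |(P A.1).toReal - (Q A.1).toReal|) := by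
  refine ⟨1, ?_⟩
  rintro _ ⟨A, rfl⟩
  have h1 := prob_toReal_le_one P A.1
  have h2 := prob_toReal_le_one Q A.1
  have h3 : 0 ≤ (P A.1).toReal := ENNReal.toReal_nonneg
  have h4 : 0 ≤ (Q A.1).toReal := ENNReal.toReal_nonneg
  exact abs_le.2 ⟨by linarith, by linarith⟩

lemma le_TV {E : Type*} [MeasurableSpace E] (P Q : Measure E) [IsProbabilityMeasure P]
    [IsProbabilityMeasure Q] (A : Set E) (hA : MeasurableSet A) :
    |(P A).toReal - (Q A).toReal| ≤ TV P Q :=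
  le_ciSup (TV_bdd P Q) ⟨A, hA⟩

lemma TV_le {E : Type*} [MeasurableSpace E] (P Q : Measure E) (c : ℝ)
    (h : ∀ A, MeasurableSet A → |(P A).toReal - (Q A).toReal| ≤ c) : TV P Q ≤ c := by
  have : Nonempty {s : Set E // MeasurableSet s} := ⟨⟨∅, MeasurableSet.empty⟩⟩
  exact ciSup_le fun A => h A.1 A.2

lemma exists_TV {E : Type*} [MeasurableSpace E] (P Q : Measure E) (z : ℝ) (hz : 0 < z) :
    ∃ A, MeasurableSet A ∧ TV P Q - z ≤ |(P A).toReal - (Q A).toReal| := by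
  have : Nonempty {s : Set E // MeasurableSet s} := ⟨⟨∅, MeasurableSet.empty⟩⟩
  obtain ⟨A, hA⟩ := exists_lt_of_lt_ciSup (show TV P Q - z < TV P Q by linarith)
  exact ⟨A.1, A.2, hA.le⟩

lemma TV_le_of_one_sided {E : Type*} [MeasurableSpace E] (P Q : Measure E) [IsProbabilityMeasure P]
    [IsProbabilityMeasure Q] (c : ℝ)
    (h : ∀ A, MeasurableSet A → (Q A).toReal - c ≤ (P A).toReal) : TV P Q ≤ c := by
  apply TV_le
  intro A hA
  have h1 := h A hA
  have h2 := h Aᶜ hA.compl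
  have e1 : (P Aᶜ).toReal = 1 - (P A).toReal := probReal_compl_eq_one_sub hA
  have e2 : (Q Aᶜ).toReal = 1 - (Q A).toReal := probReal_compl_eq_one_sub hA
  rw [e1, e2] at h2
  exact abs_le.2 ⟨by linarith, by linarith⟩

/-- Every mixture is well approximated by a mixture with rounded weights. -/
lemma mixture_approx {k : ℕ} (w μ σ : Fin k → ℝ) (h : IsMixParams1 w σ) (M : ℕ) (κ : ℝ)
    (hκ : 0 < κ) (hκ1 : κ < 1) (hM : 0 < M)
    (c : Fin k → ℕ) (hc : ∑ i, c i = M) (hcw : ∀ i, M * w i - 1 ≤ c i)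
    (μ' σ' : Fin k → ℝ) (hσ' : ∀ i, 0 < σ' i)
    (happ : ∀ i, 1 ≤ M * w i → σ i * (1 + κ / 4) ≤ σ' i ∧ σ' i ≤ σ i * (1 + κ / 2) ∧
      |μ i - μ' i| ≤ σ i * κ / 4) :
    IsMixParams1 (fun i => (c i : ℝ) / M) σ' ∧
    TV (mixture1 k (fun i => (c i : ℝ) / M) μ' σ') (mixture1 k w μ σ) ≤ k / M + κ := by
  have hMr : (0:ℝ) < M := by exact_mod_cast hM
  have hmix : IsMixParams1 (fun i => (c i : ℝ) / M) σ' := by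
    refine ⟨fun i => by positivity, ?_, hσ'⟩
    rw [← Finset.sum_div, ← Nat.cast_sum, hc, div_self hMr.ne']
  refine ⟨hmix, ?_⟩
  have := mixture1_prob _ μ' _ hmix
  have := mixture1_prob _ μ _ h
  apply TV_le_of_one_sided
  intro A hA
  rw [mixture1_toReal _ _ _ hmix A hA, mixture1_toReal _ _ _ h A hA]
  have hterm : ∀ i, w i * (gauss1 (μ i) (σ i) A).toReal - (1 / M + w i * κ) ≤
      (c i : ℝ) / M * (gauss1 (μ' i) (σ' i) A).toReal := by
    intro i
    have := gauss1_prob (μ i) _ (h.2.2 i)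
    have := gauss1_prob (μ' i) _ (hσ' i)
    have g1 := prob_toReal_le_one (gauss1 (μ i) (σ i)) A
    have g2 := prob_toReal_le_one (gauss1 (μ' i) (σ' i)) A
    have g3 : 0 ≤ (gauss1 (μ i) (σ i) A).toReal := ENNReal.toReal_nonneg
    have g4 : 0 ≤ (gauss1 (μ' i) (σ' i) A).toReal := ENNReal.toReal_nonneg
    have hw := h.1 i
    by_cases hi : 1 ≤ M * w i
    · obtain ⟨a1, a2, a3⟩ := happ i hi
      have hd := gauss1_dom (μ i) (σ i) (μ' i) (σ' i) κ (h.2.2 i) hκ hκ1 a1 a2 a3 A hA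
      have hcM : w i - 1 / M ≤ (c i : ℝ) / M := by
        rw [le_div_iff₀ hMr, sub_mul, one_div, inv_mul_cancel₀ hMr.ne']; linarith [hcw i]
      have hM1 : 0 ≤ 1 / (M:ℝ) := by positivity
      set X := (gauss1 (μ i) (σ i) A).toReal
      set Y := (gauss1 (μ' i) (σ' i) A).toReal
      have : (w i - 1 / M) * Y ≤ (c i : ℝ) / M * Y := mul_le_mul_of_nonneg_right hcM g4
      nlinarith [mul_le_mul_of_nonneg_left hd hw, mul_le_mul_of_nonneg_left g2 hM1]
    · push Not at hi
      have : w i ≤ 1 / M := by rw [le_div_iff₀ hMr]; linarith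
      have h0 : 0 ≤ (c i : ℝ) / M * (gauss1 (μ' i) (σ' i) A).toReal := by positivity
      nlinarith [mul_nonneg hw hκ.le]
  have := Finset.sum_le_sum (fun i (_ : i ∈ Finset.univ) => hterm i)
  rw [Finset.sum_sub_distrib, Finset.sum_add_distrib, ← Finset.sum_mul, h.2.1] at this
  simp only [Finset.sum_const, Finset.card_univ, Fintype.card_fin, nsmul_eq_mul] at this
  have e : (k:ℝ) * (1 / M) = k / M := by ring
  linarith


/-- number of samples in `A` -/
def cnt {n : ℕ} (A : Set ℝ) (x : Fin n → ℝ) : ℝ := ∑ j, A.indicator (fun _ => (1:ℝ)) (x j)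

lemma measurable_cnt {n : ℕ} (A : Set ℝ) (hA : MeasurableSet A) : Measurable (cnt (n := n) A) := by
  unfold cnt
  apply Finset.measurable_sum
  intro j _
  exact (measurable_const.indicator hA).comp (measurable_pi_apply j)

lemma cnt_adj {n : ℕ} (A : Set ℝ) (x x' : Fin n → ℝ) (h : Adjacent x x') :
    |cnt A x - cnt A x'| ≤ 1 := by
  obtain ⟨i, hi⟩ := h
  unfold cnt
  rw [← Finset.sum_sub_distrib, Finset.sum_eq_single i]
  · have h1 : ∀ y, 0 ≤ A.indicator (fun _ => (1:ℝ)) y := fun y =>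
      Set.indicator_nonneg (fun _ _ => zero_le_one) y
    have h2 : ∀ y, A.indicator (fun _ => (1:ℝ)) y ≤ 1 := fun y =>
      Set.indicator_le_self' (f := fun _ => (1:ℝ)) (fun _ _ => zero_le_one) y
    exact abs_le.2 ⟨by linarith [h1 (x i), h2 (x' i)], by linarith [h1 (x' i), h2 (x i)]⟩
  · intro j _ hj
    rw [hi j hj, sub_self]
  · simp

lemma hoeff_one {n : ℕ} (D : Measure ℝ) [IsProbabilityMeasure D] (f : ℝ → ℝ) (hf : Measurable f)
    (a b : ℝ) (hab : b = a + 1) (hfi : ∀ y, f y ∈ Set.Icc a b) (r : ℝ) (hr : 0 ≤ r) :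
    (Measure.pi fun _ : Fin n => D).real {x | n * r ≤ ∑ j, (f (x j) - ∫ y, f y ∂D)} ≤
      exp (-(2 * n * r ^ 2)) := by
  have hind : iIndepFun (fun (i : Fin n) (x : Fin n → ℝ) => f (x i) - ∫ y, f y ∂D)
      (Measure.pi fun _ : Fin n => D) :=
    iIndepFun_pi (X := fun _ y => f y - ∫ y, f y ∂D) (fun i => (hf.sub_const _).aemeasurable)
  have hsub : ∀ i ∈ (Finset.univ : Finset (Fin n)), HasSubgaussianMGF
      (fun x : Fin n → ℝ => f (x i) - ∫ y, f y ∂D) ((‖b - a‖₊ / 2) ^ 2)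
      (Measure.pi fun _ : Fin n => D) := by
    intro i _
    have hm : Measurable (fun x : Fin n → ℝ => f (x i)) := hf.comp (measurable_pi_apply i)
    have h := hasSubgaussianMGF_of_mem_Icc (μ := Measure.pi fun _ : Fin n => D)
      (X := fun x : Fin n → ℝ => f (x i)) (a := a) (b := b) hm.aemeasurable
      (Filter.Eventually.of_forall fun x => hfi (x i))
    have e : ∫ x, f (x i) ∂(Measure.pi fun _ : Fin n => D) = ∫ y, f y ∂D := by
      have hp := measurePreserving_eval (μ := fun _ : Fin n => D) i
      have := integral_map (μ := Measure.pi fun _ : Fin n => D) (φ := Function.eval i) hp.measurable.aemeasurable (f := f) hf.aestronglyMeasurable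
      rw [hp.map_eq] at this; exact this.symm
    rw [e] at h
    exact h
  have H := HasSubgaussianMGF.measure_sum_ge_le_of_iIndepFun hind hsub (ε := n * r) (by positivity)
  refine H.trans ?_
  apply exp_le_exp.2
  rw [hab]
  simp only [add_sub_cancel_left, nnnorm_one, Finset.sum_const, Finset.card_univ, Fintype.card_fin]
  rcases Nat.eq_zero_or_pos n with rfl | hn
  · simp
  · have : (0:ℝ) < n := by exact_mod_cast hn
    push_cast
    apply le_of_eq
    simp only [nsmul_eq_mul]
    field_simp


lemma hoeff_two {n : ℕ} (D : Measure ℝ) [IsProbabilityMeasure D] (A : Set ℝ) (hA : MeasurableSet A)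
    (r : ℝ) (hr : 0 ≤ r) :
    (Measure.pi fun _ : Fin n => D).real {x | ¬ |n * (D A).toReal - cnt A x| ≤ n * r} ≤
      2 * exp (-(2 * n * r ^ 2)) := by
  set f : ℝ → ℝ := A.indicator (fun _ => (1:ℝ)) with hfdef
  have hf : Measurable f := measurable_const.indicator hA
  have hfint0 : ∫ y, f y ∂D = (D A).toReal := by
    rw [hfdef, integral_indicator hA]; simp [Measure.real]
  have h0 : ∀ y, 0 ≤ f y := fun y => Set.indicator_nonneg (fun _ _ => zero_le_one) y
  have h1 : ∀ y, f y ≤ 1 := fun y =>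
    Set.indicator_le_self' (f := fun _ => (1:ℝ)) (fun _ _ => zero_le_one) y
  have H1 := hoeff_one (n := n) D f hf 0 1 (by norm_num) (fun y => ⟨h0 y, h1 y⟩) r hr
  have H2 := hoeff_one (n := n) D (fun y => - f y) hf.neg (-1) 0 (by norm_num)
    (fun y => ⟨by linarith [h1 y], by linarith [h0 y]⟩) r hr
  refine le_trans (measureReal_mono (s₂ := {x | n * r ≤ ∑ j, (f (x j) - ∫ y, f y ∂D)} ∪
    {x | n * r ≤ ∑ j, (- f (x j) - ∫ y, - f y ∂D)}) ?_ (measure_ne_top _ _)) ?_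
  · intro x hx
    have hx' : ¬ |n * (D A).toReal - cnt A x| ≤ n * r := hx
    have e1 : ∑ j, (f (x j) - ∫ y, f y ∂D) = cnt A x - n * (D A).toReal := by
      rw [Finset.sum_sub_distrib, hfint0]; simp [cnt, hfdef]
    have e2 : ∑ j, (- f (x j) - ∫ y, - f y ∂D) = n * (D A).toReal - cnt A x := by
      rw [Finset.sum_sub_distrib, integral_neg, hfint0]; simp [cnt, hfdef]; ring
    show (n * r ≤ ∑ j, (f (x j) - ∫ y, f y ∂D)) ∨ (n * r ≤ ∑ j, (- f (x j) - ∫ y, - f y ∂D))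
    rw [e1, e2]
    rw [abs_le, not_and_or] at hx'
    rcases hx' with h | h
    · left; push Not at h; linarith
    · right; push Not at h; linarith
  · refine le_trans (measureReal_union_le _ _) ?_
    linarith

section expmech
variable {Ω : Type*}

/-- Score of a hypothesis: the largest discrepancy over the test sets. -/
def score {n : ℕ} (H : Finset Ω) (hH : H.Nonempty) (P : Ω → Measure ℝ) (A : Ω → Ω → Set ℝ)
    (h : Ω) (x : Fin n → ℝ) : ℝ :=
  (H ×ˢ H).sup' (hH.product hH) (fun q => |n * (P h (A q.1 q.2)).toReal - cnt (A q.1 q.2) x|)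

lemma score_adj {n : ℕ} (H : Finset Ω) (hH : H.Nonempty) (P : Ω → Measure ℝ) (A : Ω → Ω → Set ℝ)
    (h : Ω) (x x' : Fin n → ℝ) (hx : Adjacent x x') :
    score H hH P A h x ≤ score H hH P A h x' + 1 := by
  unfold score
  apply Finset.sup'_le
  intro q hq
  have h1 := Finset.le_sup' (fun q : Ω × Ω => |n * (P h (A q.1 q.2)).toReal - cnt (A q.1 q.2) x'|) hq
  have h2 := cnt_adj (A q.1 q.2) x x' hx

  refine le_trans ?_ (add_le_add_left h1 1)
  have : n * (P h (A q.1 q.2)).toReal - cnt (A q.1 q.2) x =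
    (n * (P h (A q.1 q.2)).toReal - cnt (A q.1 q.2) x') - (cnt (A q.1 q.2) x - cnt (A q.1 q.2) x') := by
    ring
  rw [this]
  exact le_trans (abs_sub _ _) (by linarith)

lemma measurable_score {n : ℕ} (H : Finset Ω) (hH : H.Nonempty) (P : Ω → Measure ℝ)
    (A : Ω → Ω → Set ℝ) (hA : ∀ a b, MeasurableSet (A a b)) (h : Ω) :
    Measurable (score (n := n) H hH P A h) := by
  have : score (n := n) H hH P A h = (H ×ˢ H).sup' (hH.product hH)
      (fun q x => |n * (P h (A q.1 q.2)).toReal - cnt (A q.1 q.2) x|) := by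
    ext x
    rw [Finset.sup'_apply]
    rfl
  rw [this]
  apply Finset.measurable_sup'
  intro q _
  have := (measurable_const (a := n * (P h (A q.1 q.2)).toReal)).sub (measurable_cnt (n := n) (A q.1 q.2) (hA _ _))
  simpa [Real.norm_eq_abs] using this.norm

/-- Exponential mechanism weight. -/
def emw {n : ℕ} (H : Finset Ω) (hH : H.Nonempty) (P : Ω → Measure ℝ) (A : Ω → Ω → Set ℝ) (ε : ℝ)
    (h : Ω) (x : Fin n → ℝ) : ℝ :=
  exp (-(ε / 2 * score H hH P A h x)) / ∑ h' ∈ H, exp (-(ε / 2 * score H hH P A h' x))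

lemma emw_nonneg {n : ℕ} (H : Finset Ω) (hH : H.Nonempty) (P : Ω → Measure ℝ) (A : Ω → Ω → Set ℝ)
    (ε : ℝ) (h : Ω) (x : Fin n → ℝ) : 0 ≤ emw H hH P A ε h x := by
  unfold emw
  exact div_nonneg (exp_pos _).le (Finset.sum_nonneg fun _ _ => (exp_pos _).le)

lemma emw_sum {n : ℕ} (H : Finset Ω) (hH : H.Nonempty) (P : Ω → Measure ℝ) (A : Ω → Ω → Set ℝ)
    (ε : ℝ) (x : Fin n → ℝ) : ∑ h ∈ H, emw H hH P A ε h x = 1 := by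
  unfold emw
  rw [← Finset.sum_div, div_self]
  exact (Finset.sum_pos (fun _ _ => exp_pos _) hH).ne'

lemma Adjacent.symm' {n : ℕ} {E : Type*} {X X' : Fin n → E} (h : Adjacent X X') : Adjacent X' X := by
  obtain ⟨i, hi⟩ := h
  exact ⟨i, fun j hj => (hi j hj).symm⟩

lemma emw_adj {n : ℕ} (H : Finset Ω) (hH : H.Nonempty) (P : Ω → Measure ℝ) (A : Ω → Ω → Set ℝ)
    (ε : ℝ) (hε : 0 < ε) (h : Ω) (x x' : Fin n → ℝ) (hx : Adjacent x x') :
    emw H hH P A ε h x' ≤ exp ε * emw H hH P A ε h x := by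
  have key : ∀ (h : Ω) (x x' : Fin n → ℝ), Adjacent x x' → exp (-(ε / 2 * score H hH P A h x')) ≤
      exp (ε / 2) * exp (-(ε / 2 * score H hH P A h x)) := by
    intro h x x' hx
    rw [← exp_add]
    apply exp_le_exp.2
    have := score_adj H hH P A h x x' hx
    nlinarith
  unfold emw
  have p1 : 0 < ∑ h' ∈ H, exp (-(ε / 2 * score H hH P A h' x)) :=
    Finset.sum_pos (fun _ _ => exp_pos _) hH
  have p2 : 0 < ∑ h' ∈ H, exp (-(ε / 2 * score H hH P A h' x')) :=
    Finset.sum_pos (fun _ _ => exp_pos _) hH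
  have k1 := key h x x' hx
  have k2 : ∑ h' ∈ H, exp (-(ε / 2 * score H hH P A h' x)) ≤
      exp (ε / 2) * ∑ h' ∈ H, exp (-(ε / 2 * score H hH P A h' x')) := by
    rw [Finset.mul_sum]
    exact Finset.sum_le_sum fun h' _ => key h' x' x hx.symm'
  rw [← mul_div_assoc, div_le_div_iff₀ p2 p1]
  have e : exp ε = exp (ε / 2) * exp (ε / 2) := by rw [← exp_add]; ring_nf
  rw [e]
  calc _ ≤ (exp (ε / 2) * exp (-(ε / 2 * score H hH P A h x))) *
        (exp (ε / 2) * ∑ h' ∈ H, exp (-(ε / 2 * score H hH P A h' x'))) :=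
        mul_le_mul k1 k2 p1.le (by positivity)
    _ = _ := by ring

theorem phase2 [MeasurableSpace Ω] [MeasurableSingletonClass Ω] (H : Finset Ω) (hH : H.Nonempty)
    (P : Ω → Measure ℝ) (hP : ∀ h ∈ H, IsProbabilityMeasure (P h)) (n : ℕ) (α ε : ℝ)
    (hα : 0 < α) (hε : 0 < ε) :
    ∃ K : Kernel (Fin n → ℝ) Ω, IsMarkovKernel K ∧
      (∀ x x', Adjacent x x' → ∀ O, MeasurableSet O → K x' O ≤ ENNReal.ofReal (exp ε) * K x O) ∧
      ∀ (D : Measure ℝ) [IsProbabilityMeasure D],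
        H.card * exp (-(ε * α * n / 10)) ≤ 1 / 100 →
        2 * (H.card : ℝ) ^ 2 * exp (-(n * α ^ 2 / 50)) ≤ 1 / 100 →
        (∃ h ∈ H, TV (P h) D ≤ α / 10) →
        ENNReal.ofReal (98 / 100) ≤ ∫⁻ x, K x {h | h ∈ H ∧ TV (P h) D ≤ α}
          ∂(Measure.pi fun _ : Fin n => D) := by
  classical
  choose A hA hTV using fun a b => exists_TV (P a) (P b) (α / 5) (by linarith)
  have hmeas : ∀ h, Measurable (emw (n := n) H hH P A ε h) := by
    intro h
    unfold emw
    have hm : ∀ h, Measurable fun x : Fin n → ℝ => exp (-(ε / 2 * score H hH P A h x)) := fun h =>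
      Real.measurable_exp.comp ((measurable_score H hH P A hA h).const_mul _).neg
    exact (hm h).div (Finset.measurable_sum _ fun h' _ => hm h')
  let Kf : (Fin n → ℝ) → Measure Ω := fun x =>
    ∑ h ∈ H, ENNReal.ofReal (emw H hH P A ε h x) • Measure.dirac h
  have hKf : ∀ x O, MeasurableSet O → Kf x O =
      ENNReal.ofReal (∑ h ∈ H, emw H hH P A ε h x * O.indicator (fun _ => 1) h) := by
    intro x O hO
    simp only [Kf, Measure.coe_finsetSum, Finset.sum_apply, Measure.smul_apply, smul_eq_mul]
    rw [ENNReal.ofReal_sum_of_nonneg]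
    · apply Finset.sum_congr rfl
      intro h _
      rw [Measure.dirac_apply' _ hO, ENNReal.ofReal_mul (emw_nonneg _ _ _ _ _ _ _)]
      congr 1
      by_cases hh : h ∈ O <;> simp [hh]
    · intro h _
      exact mul_nonneg (emw_nonneg _ _ _ _ _ _ _) (Set.indicator_nonneg (fun _ _ => zero_le_one) _)
  have hKm : Measurable Kf := by
    apply Measure.measurable_of_measurable_coe
    intro O hO
    simp only [hKf _ O hO]
    apply ENNReal.measurable_ofReal.comp
    exact Finset.measurable_sum _ fun h _ => (hmeas h).mul_const _
  refine ⟨⟨Kf, hKm⟩, ⟨fun x => ⟨?_⟩⟩, ?_, ?_⟩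
  · show Kf x Set.univ = 1
    rw [hKf _ _ MeasurableSet.univ]
    simp [emw_sum]
  · intro x x' hx O hO
    show Kf x' O ≤ _ * Kf x O
    rw [hKf _ _ hO, hKf _ _ hO, ← ENNReal.ofReal_mul (exp_pos _).le]
    apply ENNReal.ofReal_le_ofReal
    rw [Finset.mul_sum]
    apply Finset.sum_le_sum
    intro h _
    rw [← mul_assoc]
    exact mul_le_mul_of_nonneg_right (emw_adj H hH P A ε hε h x x' hx)
      (Set.indicator_nonneg (fun _ _ => zero_le_one) _)
  · rintro D _ hc1 hc2 ⟨hs, hsH, hsTV⟩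
    set S : Set Ω := {h | h ∈ H ∧ TV (P h) D ≤ α} with hS
    have hSm : MeasurableSet S := (H.finite_toSet.subset (fun h hh => hh.1)).measurableSet
    show _ ≤ ∫⁻ x, Kf x S ∂_
    set E : Set (Fin n → ℝ) := {x | ∀ q ∈ H ×ˢ H,
      |n * (D (A q.1 q.2)).toReal - cnt (A q.1 q.2) x| ≤ n * (α / 10)} with hE
    have hEm : MeasurableSet E := by
      have : E = ⋂ q ∈ H ×ˢ H, {x | |n * (D (A q.1 q.2)).toReal - cnt (A q.1 q.2) x| ≤ n * (α / 10)} := by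
        ext x; simp [hE]
      rw [this]
      apply Finset.measurableSet_biInter
      intro q _
      apply measurableSet_le _ measurable_const
      have := (measurable_const (a := n * (D (A q.1 q.2)).toReal)).sub
        (measurable_cnt (n := n) (A q.1 q.2) (hA _ _))
      simpa [Real.norm_eq_abs] using this.norm
    have hEc : (Measure.pi fun _ : Fin n => D).real Eᶜ ≤ 1 / 100 := by
      have hsub : Eᶜ ⊆ ⋃ q ∈ H ×ˢ H,
          {x | ¬ |n * (D (A q.1 q.2)).toReal - cnt (A q.1 q.2) x| ≤ n * (α / 10)} := by
        intro x hx
        have hx' : ¬ ∀ q ∈ H ×ˢ H,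
          |n * (D (A q.1 q.2)).toReal - cnt (A q.1 q.2) x| ≤ n * (α / 10) := hx
        push Not at hx'
        obtain ⟨q, hq, hlt⟩ := hx'
        simp only [Set.mem_iUnion]
        exact ⟨q, hq, not_le.2 hlt⟩
      refine le_trans (measureReal_mono hsub (measure_ne_top _ _)) (le_trans (measureReal_biUnion_finset_le _ _) ?_)
      refine le_trans (Finset.sum_le_sum fun q _ => hoeff_two D (A q.1 q.2) (hA _ _) (α / 10) (by linarith)) ?_
      rw [Finset.sum_const, Finset.card_product, nsmul_eq_mul]
      refine le_trans (le_of_eq ?_) hc2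
      push_cast
      rw [show -(2 * (n:ℝ) * (α / 10) ^ 2) = -(n * α ^ 2 / 50) by ring]
      ring
    have hEp : ENNReal.ofReal (99 / 100) ≤ (Measure.pi fun _ : Fin n => D) E := by
      have e1 := probReal_compl_eq_one_sub (μ := Measure.pi fun _ : Fin n => D) hEm
      rw [ENNReal.ofReal_le_iff_le_toReal (measure_ne_top _ _)]
      have : (Measure.pi fun _ : Fin n => D).real E = ((Measure.pi fun _ : Fin n => D) E).toReal := rfl
      linarith
    have hgood : ∀ x ∈ E, ENNReal.ofReal (99 / 100) ≤ Kf x S := by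
      intro x hx
      have hx' : ∀ q ∈ H ×ˢ H,
        |n * (D (A q.1 q.2)).toReal - cnt (A q.1 q.2) x| ≤ n * (α / 10) := hx
      have hn0 : (0:ℝ) ≤ n := Nat.cast_nonneg n
      have := hP hs hsH
      have sc1 : score H hH P A hs x ≤ n * (α / 5) := by
        apply Finset.sup'_le
        intro q hq
        have h1 := hx' q hq
        have h2 := le_TV (P hs) D (A q.1 q.2) (hA _ _)
        have h3 : |n * ((P hs (A q.1 q.2)).toReal - (D (A q.1 q.2)).toReal)| ≤ n * (α / 10) := by
          rw [abs_mul, abs_of_nonneg hn0]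
          exact mul_le_mul_of_nonneg_left (h2.trans hsTV) hn0
        have : n * (P hs (A q.1 q.2)).toReal - cnt (A q.1 q.2) x =
          n * ((P hs (A q.1 q.2)).toReal - (D (A q.1 q.2)).toReal) +
          (n * (D (A q.1 q.2)).toReal - cnt (A q.1 q.2) x) := by ring
        rw [this]
        exact le_trans (abs_add_le _ _) (by linarith)
      have bad : ∀ h ∈ H, h ∉ S → n * (2 * α / 5) ≤ score H hH P A h x := by
        intro h hh hhS
        by_contra hlt
        push Not at hlt
        apply hhS
        refine ⟨hh, ?_⟩
        have := hP h hh
        have hq : (h, hs) ∈ H ×ˢ H := Finset.mk_mem_product hh hsH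
        have a1 := Finset.le_sup' (fun q : Ω × Ω => |n * (P h (A q.1 q.2)).toReal - cnt (A q.1 q.2) x|) hq
        have a2 := Finset.le_sup' (fun q : Ω × Ω => |n * (P hs (A q.1 q.2)).toReal - cnt (A q.1 q.2) x|) hq
        simp only at a1 a2
        have b1 : |n * (P h (A h hs)).toReal - cnt (A h hs) x| < n * (2 * α / 5) := lt_of_le_of_lt a1 hlt
        have b2 : |n * (P hs (A h hs)).toReal - cnt (A h hs) x| ≤ n * (α / 5) := le_trans a2 sc1
        have hnpos : (0:ℝ) < n := by
          rcases hn0.eq_or_lt with h0 | h0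
          · rw [← h0] at b1; simp only [zero_mul] at b1; exact absurd b1 (not_lt.2 (abs_nonneg _))
          · exact h0
        have b3 : |n * ((P h (A h hs)).toReal - (P hs (A h hs)).toReal)| ≤ n * (3 * α / 5) := by
          have e : n * ((P h (A h hs)).toReal - (P hs (A h hs)).toReal) =
            (n * (P h (A h hs)).toReal - cnt (A h hs) x) -
            (n * (P hs (A h hs)).toReal - cnt (A h hs) x) := by ring
          rw [e]
          exact le_trans (abs_sub _ _) (by linarith)
        rw [abs_mul, abs_of_nonneg hn0] at b3
        have b4 := le_of_mul_le_mul_left b3 hnpos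
        have b5 := hTV h hs
        apply TV_le
        intro B hB
        have c1 := le_TV (P h) (P hs) B hB
        have c2 := le_TV (P hs) D B hB
        have e : (P h B).toReal - (D B).toReal = ((P h B).toReal - (P hs B).toReal) +
          ((P hs B).toReal - (D B).toReal) := by ring
        rw [e]
        exact le_trans (abs_add_le _ _) (by linarith)
      rw [hKf _ _ hSm]
      apply ENNReal.ofReal_le_ofReal
      have hZ : exp (-(ε / 2 * (n * (α / 5)))) ≤ ∑ h' ∈ H, exp (-(ε / 2 * score H hH P A h' x)) := by
        refine le_trans ?_ (Finset.single_le_sum (f := fun h' => exp (-(ε / 2 * score H hH P A h' x)))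
          (fun _ _ => (exp_pos _).le) hsH)
        apply exp_le_exp.2
        have := mul_le_mul_of_nonneg_left sc1 (show 0 ≤ ε / 2 by linarith)
        linarith
      have hterm : ∀ h ∈ H, emw H hH P A ε h x - exp (-(ε * α * n / 10)) ≤
          emw H hH P A ε h x * S.indicator (fun _ => 1) h := by
        intro h hh
        by_cases hhS : h ∈ S
        · rw [Set.indicator_of_mem hhS, mul_one]; linarith [exp_pos (-(ε * α * n / 10))]
        · rw [Set.indicator_of_notMem hhS, mul_zero, sub_nonpos]
          unfold emw
          rw [div_le_iff₀ (lt_of_lt_of_le (exp_pos _) hZ)]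
          refine le_trans ?_ (mul_le_mul_of_nonneg_left hZ (exp_pos _).le)
          rw [← exp_add]
          apply exp_le_exp.2
          have := mul_le_mul_of_nonneg_left (bad h hh hhS) (show 0 ≤ ε / 2 by linarith)
          nlinarith
      have := Finset.sum_le_sum hterm
      rw [Finset.sum_sub_distrib, emw_sum, Finset.sum_const, nsmul_eq_mul] at this
      linarith
    calc ENNReal.ofReal (98 / 100) ≤ ENNReal.ofReal (99 / 100) * ENNReal.ofReal (99 / 100) := by
          rw [← ENNReal.ofReal_mul (by norm_num)]
          exact ENNReal.ofReal_le_ofReal (by norm_num)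
      _ ≤ ENNReal.ofReal (99 / 100) * (Measure.pi fun _ : Fin n => D) E := by gcongr
      _ = ∫⁻ _ in E, ENNReal.ofReal (99 / 100) ∂(Measure.pi fun _ : Fin n => D) := by
          rw [setLIntegral_const]
      _ ≤ ∫⁻ x in E, Kf x S ∂(Measure.pi fun _ : Fin n => D) := setLIntegral_mono' hEm hgood
      _ ≤ _ := setLIntegral_le_lintegral _ _
end expmech


open Classical in
/-- Number of groups voting for `b`. -/
def bcount {T : ℕ} {B : Type*} (V : Fin T → Finset B) (b : B) : ℕ :=
  (Finset.univ.filter (fun g => b ∈ V g)).card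

open Classical in
/-- All bins voted for. -/
def bsupp {T : ℕ} {B : Type*} (V : Fin T → Finset B) : Finset B := Finset.univ.biUnion V

lemma mem_bsupp {T : ℕ} {B : Type*} (V : Fin T → Finset B) (b : B) : b ∈ bsupp V ↔ ∃ g, b ∈ V g := by
  simp [bsupp]

lemma bcount_zero {T : ℕ} {B : Type*} (V : Fin T → Finset B) (b : B) (h : b ∉ bsupp V) :
    bcount V b = 0 := by
  rw [mem_bsupp] at h
  push Not at h
  simp [bcount, h]

/-- The randomized selection of popular bins. -/
def sel {T : ℕ} {B : Type*} (e : ℝ) (t : ℕ) (V : Fin T → Finset B) (φ : Finset B → ℝ) : ℝ :=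
  subE (bsupp V) (fun b => incl e t (bcount V b)) φ

open Classical in
lemma bcount_le {T : ℕ} {B : Type*} (V V' : Fin T → Finset B) (g0 : Fin T)
    (hg : ∀ g, g ≠ g0 → V g = V' g) (b : B) : bcount V b ≤ bcount V' b + 1 := by
  unfold bcount
  have : Finset.univ.filter (fun g => b ∈ V g) ⊆ insert g0 (Finset.univ.filter (fun g => b ∈ V' g)) := by
    intro g hgm
    simp only [Finset.mem_filter, Finset.mem_univ, true_and, Finset.mem_insert] at hgm ⊢
    by_cases h : g = g0
    · exact Or.inl h
    · right; rw [← hg g h]; exact hgm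
  exact (Finset.card_le_card this).trans (Finset.card_insert_le _ _)

lemma exp_six (c : ℕ) (hc : c ≤ 6) (e d s : ℝ) (he : 0 ≤ e) (hd : 0 ≤ d) (hs : 0 ≤ s) :
    exp (c * e) * s + c * exp (c * e) * (2 * d) ≤ exp (6 * e) * s + 6 * exp (6 * e) * (2 * d) := by
  have h6 : (c:ℝ) ≤ 6 := by exact_mod_cast hc
  have h1 : exp (c * e) ≤ exp (6 * e) := exp_le_exp.2 (mul_le_mul_of_nonneg_right h6 he)
  gcongr

open Classical in
lemma sel_dp {T : ℕ} {B : Type*} (e d : ℝ) (he : 0 ≤ e) (hd : 0 ≤ d) (t : ℕ) (ht : 1 ≤ t)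
    (htd : exp (-(e * (t - 1))) ≤ d) (V V' : Fin T → Finset B) (g0 : Fin T)
    (hg : ∀ g, g ≠ g0 → V g = V' g) (h3 : (V g0 \ V' g0).card ≤ 3) (h3' : (V' g0 \ V g0).card ≤ 3)
    (φ : Finset B → ℝ) (hφ0 : ∀ R, 0 ≤ φ R) (hφ1 : ∀ R, φ R ≤ 1) :
    sel e t V' φ ≤ exp (6 * e) * sel e t V φ + 6 * exp (6 * e) * (2 * d) := by
  unfold sel
  set p := fun b => incl e t (bcount V b) with hp
  set p' := fun b => incl e t (bcount V' b) with hp'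
  have e1 := subE_superset (bsupp V) (bsupp V') p φ (fun b hb => by simp [hp, bcount_zero V b hb, incl])
  have e2 := subE_superset (bsupp V') (bsupp V) p' φ (fun b hb => by simp [hp', bcount_zero V' b hb, incl])
  rw [← e1, ← e2, Finset.union_comm (bsupp V) (bsupp V')]
  set S := bsupp V' ∪ bsupp V
  set F := (V g0 \ V' g0) ∪ (V' g0 \ V g0) with hF
  have hc := fun b => incl_close e d he hd t (bcount V' b) (bcount V b) ht htd
      (bcount_le V' V g0 (fun g h => (hg g h).symm) b) (bcount_le V V' g0 hg b)
  have key := subE_close S F p' p (fun b => incl_nonneg _ _ _) (fun b => incl_le_one _ _ _)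
    (fun b => incl_nonneg _ _ _) (fun b => incl_le_one _ _ _) e d he hd ?_
    (fun b => (hc b).1) (fun b => (hc b).2) φ hφ0 hφ1
  · refine key.trans (exp_six _ ?_ e d _ he hd ?_)
    · refine (Finset.card_le_card Finset.inter_subset_left).trans ((Finset.card_union_le _ _).trans ?_)
      omega
    · have := subE_mono S p (fun _ => 0) φ (fun b => incl_nonneg _ _ _) (fun b => incl_le_one _ _ _) hφ0
      refine le_trans (le_of_eq ?_) this
      simp [subE]
  · intro b hb
    have : bcount V' b = bcount V b := by
      unfold bcount
      congr 1
      ext g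
      simp only [Finset.mem_filter, Finset.mem_univ, true_and]
      by_cases h : g = g0
      · subst h
        simp only [hF, Finset.mem_union, Finset.mem_sdiff] at hb
        tauto
      · rw [hg g h]
    simp [hp, hp', this]

lemma sel_one {T : ℕ} {B : Type*} (e : ℝ) (t : ℕ) (V : Fin T → Finset B) :
    sel e t V (fun _ => 1) = 1 := subE_one _ _

lemma sel_mono {T : ℕ} {B : Type*} (e : ℝ) (t : ℕ) (V : Fin T → Finset B) (φ ψ : Finset B → ℝ)
    (h : ∀ R, φ R ≤ ψ R) : sel e t V φ ≤ sel e t V ψ :=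
  subE_mono _ _ _ _ (fun b => incl_nonneg _ _ _) (fun b => incl_le_one _ _ _) h

lemma sel_const {T : ℕ} {B : Type*} (e : ℝ) (t : ℕ) (V : Fin T → Finset B) (φ : Finset B → ℝ) (a : ℝ) :
    sel e t V (fun R => a * φ R) = a * sel e t V φ := by
  unfold sel subE
  rw [Finset.mul_sum]
  refine Finset.sum_congr rfl fun R _ => by ring

/-- Weight of an outcome `R`. -/
lemma sel_ge {T : ℕ} {B : Type*} (e : ℝ) (t : ℕ) (V : Fin T → Finset B) (φ ψ : Finset B → ℝ)
    (h : ∀ R, R ⊆ bsupp V → (∀ b ∈ bsupp V, 2 * t ≤ bcount V b → b ∈ R) → φ R ≤ ψ R) :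
    sel e t V φ ≤ sel e t V ψ := by
  classical
  unfold sel subE
  apply Finset.sum_le_sum
  intro R hR
  by_cases hgood : ∀ b ∈ bsupp V, 2 * t ≤ bcount V b → b ∈ R
  · refine mul_le_mul_of_nonneg_left (h R (Finset.mem_powerset.1 hR) hgood) ?_
    convert subE_w_nonneg (bsupp V) R (fun b => incl e t (bcount V b)) (fun b => incl_nonneg _ _ _)
      (fun b => incl_le_one _ _ _)
  · push Not at hgood
    obtain ⟨b, hb, hcb, hbR⟩ := hgood
    have hz : ∏ b ∈ bsupp V, (if b ∈ R then incl e t (bcount V b) else 1 - incl e t (bcount V b)) = 0 := by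
      apply Finset.prod_eq_zero hb
      rw [if_neg hbR]
      have : bcount V b ≠ 0 := by
        rw [mem_bsupp] at hb
        obtain ⟨g, hg⟩ := hb
        unfold bcount
        rw [Finset.card_ne_zero]
        exact ⟨g, by simp [hg]⟩
      unfold incl
      rw [if_neg this, if_pos hcb]
      ring
    have : ∀ c : ℝ, (∏ b ∈ bsupp V, (if b ∈ R then incl e t (bcount V b) else 1 - incl e t (bcount V b))) * c = 0 := by
      intro c; rw [hz, zero_mul]
    refine le_of_eq ?_
    convert (rfl : (0:ℝ) = 0)
    · convert this _
    · convert this _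

section comb
variable {Ω : Type*} [MeasurableSpace Ω] {n2 T : ℕ} {B : Type*}

open Classical in
/-- Mixture over selected subsets of the second stage mechanisms. -/
def combM (e : ℝ) (t : ℕ) (K2 : Finset B → Kernel (Fin n2 → ℝ) Ω)
    (V : Fin T → Finset B) (x : Fin n2 → ℝ) : Measure Ω :=
  ∑ R ∈ (bsupp V).powerset, ENNReal.ofReal (∏ b ∈ bsupp V, if b ∈ R then incl e t (bcount V b)
    else 1 - incl e t (bcount V b)) • K2 R x

lemma combM_apply (e : ℝ) (t : ℕ) (K2 : Finset B → Kernel (Fin n2 → ℝ) Ω)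
    (hK : ∀ R, IsMarkovKernel (K2 R)) (V : Fin T → Finset B) (x : Fin n2 → ℝ) (O : Set Ω) :
    combM e t K2 V x O = ENNReal.ofReal (sel e t V (fun R => (K2 R x O).toReal)) := by
  classical
  unfold combM sel subE
  rw [ENNReal.ofReal_sum_of_nonneg]
  · simp only [Measure.coe_finsetSum, Finset.sum_apply, Measure.smul_apply, smul_eq_mul]
    apply Finset.sum_congr rfl
    intro R _
    rw [ENNReal.ofReal_mul, ENNReal.ofReal_toReal (measure_ne_top _ _)]
    convert subE_w_nonneg (bsupp V) R (fun b => incl e t (bcount V b)) (fun b => incl_nonneg _ _ _)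
      (fun b => incl_le_one _ _ _)
  · intro R _
    refine mul_nonneg ?_ ENNReal.toReal_nonneg
    convert subE_w_nonneg (bsupp V) R (fun b => incl e t (bcount V b)) (fun b => incl_nonneg _ _ _)
      (fun b => incl_le_one _ _ _)

end comb


/-- The votes of all groups. -/
def allVotes {T N : ℕ} (x : Fin T × Fin N → ℝ) : Fin T → Finset (ℤ × ℤ) :=
  fun g => votes (fun j => x (g, j))

instance instMSVotes {T : ℕ} : MeasurableSpace (Fin T → Finset (ℤ × ℤ)) := ⊤

instance instDMSVotes {T : ℕ} : @MeasurableSingletonClass (Fin T → Finset (ℤ × ℤ)) instMSVotes :=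
  ⟨fun _ => trivial⟩

lemma measurable_allVotes {T N : ℕ} :
    Measurable (allVotes : (Fin T × Fin N → ℝ) → (Fin T → Finset (ℤ × ℤ))) := by
  apply measurable_to_countable'
  intro V
  have : (allVotes ⁻¹' {V} : Set (Fin T × Fin N → ℝ)) = ⋂ g, ⋂ b : ℤ × ℤ,
      {x | b ∈ votes (fun j => x (g, j)) ↔ b ∈ V g} := by
    ext x
    simp only [Set.mem_preimage, Set.mem_singleton_iff, Set.mem_iInter, Set.mem_ofPred_eq]
    constructor
    · intro h g b; rw [← h]; rfl
    · intro h; funext g; ext b; exact h g b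
  rw [this]
  refine MeasurableSet.iInter fun g => MeasurableSet.iInter fun b => ?_
  have hm : MeasurableSet {x : Fin T × Fin N → ℝ | b ∈ votes (fun j => x (g, j))} := by
    have hf : Measurable (fun (x : Fin T × Fin N → ℝ) (j : Fin N) => x (g, j)) :=
      measurable_pi_lambda _ fun j => measurable_pi_apply _
    exact hf (measurable_mem_votes b)
  by_cases hb : b ∈ V g
  · simpa [hb] using hm
  · simp only [hb, iff_false]; exact hm.compl

section
variable {Ω : Type*} [MeasurableSpace Ω] {n2 T N n : ℕ}

lemma split_mp (eq : (Fin T × Fin N) ⊕ Fin n2 ≃ Fin n) (D : Measure ℝ) [IsProbabilityMeasure D] :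
    MeasurePreserving (fun x : Fin n → ℝ => ((fun q => x (eq (Sum.inl q))), (fun j => x (eq (Sum.inr j)))))
      (Measure.pi fun _ => D)
      ((Measure.pi fun _ : Fin T × Fin N => D).prod (Measure.pi fun _ : Fin n2 => D)) := by
  have h1 := (measurePreserving_piCongrLeft (α := fun _ : Fin n => ℝ) (fun _ => D) eq).symm
  have h2 := measurePreserving_sumPiEquivProdPi (X := fun _ : (Fin T × Fin N) ⊕ Fin n2 => ℝ) (fun _ => D)
  exact h2.comp h1

theorem mech (eq : (Fin T × Fin N) ⊕ Fin n2 ≃ Fin n)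
    (K2 : Finset (ℤ × ℤ) → Kernel (Fin n2 → ℝ) Ω) (hK : ∀ R, IsMarkovKernel (K2 R))
    (ε δ e d : ℝ) (t : ℕ) (hε : 0 < ε)
    (hdp : ∀ R x x', Adjacent x x' → ∀ O, MeasurableSet O →
      K2 R x' O ≤ ENNReal.ofReal (exp ε) * K2 R x O)
    (he : 0 ≤ e) (hd : 0 ≤ d) (ht : 1 ≤ t) (htd : exp (-(e * (t - 1))) ≤ d)
    (he6 : 6 * e = ε) (hd6 : 6 * exp ε * (2 * d) ≤ δ) :
    ∃ K : Kernel (Fin n → ℝ) Ω, IsMarkovKernel K ∧ IsDP K ε δ ∧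
      ∀ (D : Measure ℝ) [IsProbabilityMeasure D] (S : Set Ω), MeasurableSet S →
      ∀ (E : Set (Fin T × Fin N → ℝ)), MeasurableSet E →
        ENNReal.ofReal (99 / 100) ≤ (Measure.pi fun _ => D) E →
        (∀ x1 ∈ E, ∀ R, R ⊆ bsupp (allVotes x1) →
          (∀ b ∈ bsupp (allVotes x1), 2 * t ≤ bcount (allVotes x1) b → b ∈ R) →
          ENNReal.ofReal (98 / 100) ≤ ∫⁻ x2, K2 R x2 S ∂(Measure.pi fun _ => D)) →
        ENNReal.ofReal (97 / 100) ≤ ∫⁻ x, K x S ∂(Measure.pi fun _ => D) := by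
  classical
  let G : (Fin T → Finset (ℤ × ℤ)) × (Fin n2 → ℝ) → Measure Ω := fun q => combM e t K2 q.1 q.2
  have hG : Measurable G := by
    apply measurable_from_prod_countable_right
    intro V
    apply Measure.measurable_of_measurable_coe
    intro O hO
    simp only [G, combM, Measure.coe_finsetSum, Finset.sum_apply, Measure.smul_apply, smul_eq_mul]
    exact Finset.measurable_sum _ fun R _ => ((K2 R).measurable_coe hO).const_mul _
  let sp : (Fin n → ℝ) → (Fin T × Fin N → ℝ) × (Fin n2 → ℝ) :=
    fun x => ((fun q => x (eq (Sum.inl q))), (fun j => x (eq (Sum.inr j))))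
  have hsp : Measurable sp := by
    refine Measurable.prodMk ?_ ?_
    · exact measurable_pi_lambda _ fun j => measurable_pi_apply _
    · exact measurable_pi_lambda _ fun j => measurable_pi_apply _
  let G' : (Fin T × Fin N → ℝ) × (Fin n2 → ℝ) → Measure Ω := fun q => G (allVotes q.1, q.2)
  have hG' : Measurable G' := hG.comp ((measurable_allVotes.comp measurable_fst).prodMk measurable_snd)
  let Kf : (Fin n → ℝ) → Measure Ω := fun x => G' (sp x)
  have hKf : Measurable Kf := hG'.comp hsp
  have happ : ∀ x O, Kf x O = ENNReal.ofReal (sel e t (allVotes (sp x).1)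
      (fun R => (K2 R (sp x).2 O).toReal)) := fun x O => combM_apply e t K2 hK _ _ _
  refine ⟨⟨Kf, hKf⟩, ⟨fun x => ⟨?_⟩⟩, ?_, ?_⟩
  · show Kf x Set.univ = 1
    rw [happ]; simp [sel_one]
  · rintro x x' ⟨i, hi⟩ O hO
    show Kf x' O ≤ _ * Kf x O + _
    have hs0 : 0 ≤ sel e t (allVotes (sp x).1) (fun R => (K2 R (sp x).2 O).toReal) := by
      have := sel_mono e t (allVotes (sp x).1) (fun _ => 0) (fun R => (K2 R (sp x).2 O).toReal)
        (fun R => ENNReal.toReal_nonneg)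
      refine le_trans (le_of_eq ?_) this
      simp [sel, subE]
    have hδ : 0 ≤ δ := le_trans (by positivity) hd6
    rw [happ, happ, ← ENNReal.ofReal_mul (exp_pos _).le, ← ENNReal.ofReal_add
      (mul_nonneg (exp_pos _).le hs0) hδ]
    apply ENNReal.ofReal_le_ofReal
    rcases hcase : eq.symm i with ⟨g, j⟩ | j
    · have hi' : i = eq (Sum.inl (g, j)) := by rw [← hcase]; simp
      have h2 : (sp x').2 = (sp x).2 := by
        funext l
        refine (hi _ ?_).symm
        rw [hi']; intro h; have := eq.injective h; simp at this
      rw [h2]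
      have h1 : ∀ q, q ≠ (g, j) → (sp x).1 q = (sp x').1 q := by
        intro q hq
        refine hi _ ?_
        rw [hi']; intro h; have := eq.injective h
        exact hq (Sum.inl.inj this)
      have key := sel_dp e d he hd t ht htd (allVotes (sp x).1) (allVotes (sp x').1) g ?_ ?_ ?_
        (fun R => (K2 R (sp x).2 O).toReal) (fun R => ENNReal.toReal_nonneg) (fun R => ?_)
      · rw [he6] at key
        linarith
      · intro g' hg'
        unfold allVotes
        congr 1
        funext l
        exact h1 _ (fun h => hg' (Prod.ext_iff.1 h).1)
      · unfold allVotes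
        convert votes_diff (fun l => (sp x).1 (g, l)) (fun l => (sp x').1 (g, l)) j
          (fun l hl => h1 _ (fun h => hl (Prod.ext_iff.1 h).2))
      · unfold allVotes
        convert votes_diff (fun l => (sp x').1 (g, l)) (fun l => (sp x).1 (g, l)) j
          (fun l hl => (h1 _ (fun h => hl (Prod.ext_iff.1 h).2)).symm)
      · have : K2 R (sp x).2 O ≤ 1 := prob_le_one
        exact ENNReal.toReal_le_of_le_ofReal zero_le_one (by simpa using this)
    · have hi' : i = eq (Sum.inr j) := by rw [← hcase]; simp
      have h1 : (sp x').1 = (sp x).1 := by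
        funext l
        refine (hi _ ?_).symm
        rw [hi']; intro h; have := eq.injective h; simp at this
      rw [h1]
      have h2 : Adjacent (sp x).2 (sp x').2 := by
        refine ⟨j, fun l hl => hi _ ?_⟩
        rw [hi']; intro h; have := eq.injective h
        exact hl (Sum.inr.inj this)
      rw [← sel_const]
      refine le_trans (sel_mono e t _ _ (fun R => exp ε * (K2 R (sp x).2 O).toReal) fun R => ?_) (by linarith)
      have h3 := hdp R _ _ h2 O hO
      have h4 := ENNReal.toReal_mono (ENNReal.mul_ne_top ENNReal.ofReal_ne_top (measure_ne_top _ _)) h3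
      rw [ENNReal.toReal_mul, ENNReal.toReal_ofReal (exp_pos _).le] at h4
      exact h4
  · intro D _ S hS E hE hEp hgood
    show _ ≤ ∫⁻ x, G' (sp x) S ∂_
    have hmp := split_mp (n := n) eq D
    have hGS : Measurable (fun q => G' q S) := (Measure.measurable_coe hS).comp hG'
    rw [show ∫⁻ x, G' (sp x) S ∂(Measure.pi fun _ => D) = ∫⁻ q, G' q S
      ∂((Measure.pi fun _ : Fin T × Fin N => D).prod (Measure.pi fun _ : Fin n2 => D)) from
      hmp.lintegral_comp hGS]
    rw [lintegral_prod _ hGS.aemeasurable]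
    have hin : ∀ x1 ∈ E, ENNReal.ofReal (98 / 100) ≤
        ∫⁻ x2, G' (x1, x2) S ∂(Measure.pi fun _ : Fin n2 => D) := by
      intro x1 hx1
      let K3 : Finset (ℤ × ℤ) → Kernel (Fin n2 → ℝ) Ω := fun R =>
        Kernel.const _ ((Measure.pi fun _ : Fin n2 => D).bind (K2 R))
      have hK3 : ∀ R, IsMarkovKernel (K3 R) := fun R => by
        have : IsProbabilityMeasure ((Measure.pi fun _ : Fin n2 => D).bind (K2 R)) := by infer_instance
        infer_instance
      have e1 : ∫⁻ x2, G' (x1, x2) S ∂(Measure.pi fun _ : Fin n2 => D) =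
          combM e t K3 (allVotes x1) (fun _ => 0) S := by
        simp only [G', G, combM, Measure.coe_finsetSum, Finset.sum_apply, Measure.smul_apply, smul_eq_mul]
        rw [lintegral_finsetSum _ (fun R _ => ((K2 R).measurable_coe hS).const_mul _)]
        refine Finset.sum_congr rfl fun R _ => ?_
        rw [lintegral_const_mul _ ((K2 R).measurable_coe hS)]
        have hb : (K3 R (fun _ => 0)) S = ∫⁻ a, K2 R a S ∂(Measure.pi fun _ : Fin n2 => D) :=
          Measure.bind_apply hS (K2 R).measurable.aemeasurable
        rw [hb]
        congr!
      rw [e1, combM_apply e t K3 hK3]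
      apply ENNReal.ofReal_le_ofReal
      have h1 : sel e t (allVotes x1) (fun _ => (98 / 100 : ℝ) * 1) = 98 / 100 := by
        rw [sel_const, sel_one, mul_one]
      rw [← h1]
      apply sel_ge
      intro R hR hR2
      have h3 := hgood x1 hx1 R hR hR2
      simp only [K3, Kernel.const_apply]
      rw [Measure.bind_apply hS (K2 R).measurable.aemeasurable, mul_one,
        ← ENNReal.ofReal_le_iff_le_toReal]
      · exact h3
      · rw [← Measure.bind_apply hS (K2 R).measurable.aemeasurable]
        have : IsProbabilityMeasure ((Measure.pi fun _ : Fin n2 => D).bind (K2 R)) := by infer_instance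
        exact measure_ne_top _ _
    calc ENNReal.ofReal (97 / 100) ≤ ENNReal.ofReal (98 / 100) * ENNReal.ofReal (99 / 100) := by
          rw [← ENNReal.ofReal_mul (by norm_num)]
          exact ENNReal.ofReal_le_ofReal (by norm_num)
      _ ≤ ENNReal.ofReal (98 / 100) * (Measure.pi fun _ : Fin T × Fin N => D) E := by gcongr
      _ = ∫⁻ x1 in E, ENNReal.ofReal (98 / 100) ∂(Measure.pi fun _ : Fin T × Fin N => D) := by
          rw [setLIntegral_const]
      _ ≤ ∫⁻ x1 in E, ∫⁻ x2, G' (x1, x2) S ∂(Measure.pi fun _ : Fin n2 => D)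
            ∂(Measure.pi fun _ : Fin T × Fin N => D) := setLIntegral_mono' hE hin
      _ ≤ _ := setLIntegral_le_lintegral _ _
end


lemma miss_prob {T N : ℕ} (D : Measure ℝ) [IsProbabilityMeasure D] (A : Set ℝ) (hA : MeasurableSet A)
    (g : Fin T) (p : ℝ) (hp : p ≤ (D A).toReal) :
    (Measure.pi fun _ : Fin T × Fin N => D).real {x | ∀ j, x (g, j) ∉ A} ≤ exp (-(N * p)) := by
  classical
  have hset : {x : Fin T × Fin N → ℝ | ∀ j, x (g, j) ∉ A} =
      Set.univ.pi (fun q : Fin T × Fin N => if q.1 = g then Aᶜ else Set.univ) := by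
    ext x
    simp only [Set.mem_ofPred_eq, Set.mem_univ_pi]
    constructor
    · rintro h ⟨g', j⟩
      by_cases hg : g' = g
      · subst hg; simpa using h j
      · simp [hg]
    · intro h j
      simpa using h (g, j)
  rw [hset, Measure.real, Measure.pi_pi, ENNReal.toReal_prod, Fintype.prod_prod_type]
  have h1 : ∀ g' : Fin T, ∏ j : Fin N, (D (if (g', j).1 = g then Aᶜ else Set.univ)).toReal =
      if g' = g then (D Aᶜ).toReal ^ N else 1 := by
    intro g'
    by_cases hg : g' = g
    · simp [hg]
    · simp [hg]
  simp only [h1, Finset.prod_ite_eq', Finset.mem_univ, if_true]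
  have h2 : (D Aᶜ).toReal = 1 - (D A).toReal := by
    have := probReal_compl_eq_one_sub (μ := D) hA
    exact this
  have h3 : (D Aᶜ).toReal ≤ exp (-p) := by
    rw [h2]
    have := add_one_le_exp (-p)
    linarith
  calc (D Aᶜ).toReal ^ N ≤ exp (-p) ^ N := by gcongr
    _ = exp (-(N * p)) := by rw [← exp_nat_mul]; ring_nf

/-- The event that every group sees all heavy components. -/
def goodEv {k : ℕ} (T N M : ℕ) (w μ σ : Fin k → ℝ) : Set (Fin T × Fin N → ℝ) :=
  {x | ∀ g : Fin T, ∀ i : Fin k, 1 ≤ M * w i →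
    (∃ j, x (g, j) ∈ Set.Icc (μ i - σ i) (μ i - σ i + σ i / 2)) ∧
    (∃ j, x (g, j) ∈ Set.Icc (μ i + σ i / 2) (μ i + σ i / 2 + σ i / 2))}

lemma measurableSet_goodEv {k : ℕ} (T N M : ℕ) (w μ σ : Fin k → ℝ) :
    MeasurableSet (goodEv T N M w μ σ) := by
  have : goodEv T N M w μ σ = ⋂ g : Fin T, ⋂ i : Fin k, ⋂ _ : 1 ≤ M * w i,
    ((⋃ j : Fin N, (fun x : Fin T × Fin N → ℝ => x (g, j)) ⁻¹' Set.Icc (μ i - σ i) (μ i - σ i + σ i / 2)) ∩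
    (⋃ j : Fin N, (fun x : Fin T × Fin N → ℝ => x (g, j)) ⁻¹' Set.Icc (μ i + σ i / 2) (μ i + σ i / 2 + σ i / 2))) := by
    ext x
    simp only [goodEv, Set.mem_ofPred_eq, Set.mem_iInter, Set.mem_inter_iff, Set.mem_iUnion, Set.mem_preimage]
  rw [this]
  refine MeasurableSet.iInter fun g => MeasurableSet.iInter fun i => MeasurableSet.iInter fun _ => ?_
  exact (MeasurableSet.iUnion fun j => (measurable_pi_apply _) measurableSet_Icc).inter
    (MeasurableSet.iUnion fun j => (measurable_pi_apply _) measurableSet_Icc)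

lemma heavy_mass {k : ℕ} (M : ℕ) (w μ σ : Fin k → ℝ) (h : IsMixParams1 w σ) (i : Fin k)
    (hM : 0 < M) (hi : 1 ≤ M * w i) (a : ℝ) (h1 : μ i - σ i ≤ a) (h2 : a + σ i / 2 ≤ μ i + σ i) :
    1 / (12 * M) ≤ (mixture1 k w μ σ (Set.Icc a (a + σ i / 2))).toReal := by
  rw [mixture1_toReal w μ σ h _ measurableSet_Icc]
  have hMr : (0:ℝ) < M := by exact_mod_cast hM
  refine le_trans ?_ (Finset.single_le_sum (f := fun i' => w i' * (gauss1 (μ i') (σ i')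
    (Set.Icc a (a + σ i / 2))).toReal) (fun i' _ => mul_nonneg (h.1 i') ENNReal.toReal_nonneg) (Finset.mem_univ i))
  have hm := gauss1_mass (μ i) (σ i) a (h.2.2 i) h1 h2
  have hw : 1 / M ≤ w i := by rw [div_le_iff₀ hMr]; linarith
  calc 1 / (12 * (M:ℝ)) = 1 / M * (1 / 12) := by field_simp
    _ ≤ _ := mul_le_mul hw hm (by norm_num) (h.1 i)

lemma goodEv_prob {k : ℕ} (T N M : ℕ) (w μ σ : Fin k → ℝ) (h : IsMixParams1 w σ) (hM : 0 < M)
    (hT : 2 * k * T * exp (-(N * (1 / (12 * M)))) ≤ 1 / 100) :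
    ENNReal.ofReal (99 / 100) ≤ (Measure.pi fun _ => mixture1 k w μ σ) (goodEv T N M w μ σ) := by
  have := mixture1_prob w μ σ h
  set D := mixture1 k w μ σ with hD
  have hEm := measurableSet_goodEv T N M w μ σ
  have hEc : (Measure.pi fun _ : Fin T × Fin N => D).real (goodEv T N M w μ σ)ᶜ ≤ 1 / 100 := by
    let I : Finset (Fin T × Fin k) := (Finset.univ : Finset (Fin T × Fin k)).filter (fun q => 1 ≤ M * w q.2)
    have hsub : (goodEv T N M w μ σ)ᶜ ⊆ ⋃ q ∈ I,
        ({x : Fin T × Fin N → ℝ | ∀ j, x (q.1, j) ∉ Set.Icc (μ q.2 - σ q.2) (μ q.2 - σ q.2 + σ q.2 / 2)} ∪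
        {x : Fin T × Fin N → ℝ | ∀ j, x (q.1, j) ∉ Set.Icc (μ q.2 + σ q.2 / 2) (μ q.2 + σ q.2 / 2 + σ q.2 / 2)}) := by
      intro x hx
      have hx' : ¬ ∀ g : Fin T, ∀ i : Fin k, 1 ≤ M * w i →
        (∃ j, x (g, j) ∈ Set.Icc (μ i - σ i) (μ i - σ i + σ i / 2)) ∧
        (∃ j, x (g, j) ∈ Set.Icc (μ i + σ i / 2) (μ i + σ i / 2 + σ i / 2)) := hx
      rw [not_forall] at hx'
      obtain ⟨g, hx'⟩ := hx'
      rw [not_forall] at hx'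
      obtain ⟨i, hx'⟩ := hx'
      rw [Classical.not_imp, not_and_or, not_exists, not_exists] at hx'
      simp only [Set.mem_iUnion]
      exact ⟨(g, i), by simp [I, hx'.1], hx'.2⟩
    refine le_trans (measureReal_mono hsub (measure_ne_top _ _))
      (le_trans (measureReal_biUnion_finset_le _ _) ?_)
    have hterm : ∀ q ∈ I, (Measure.pi fun _ : Fin T × Fin N => D).real
        ({x : Fin T × Fin N → ℝ | ∀ j, x (q.1, j) ∉ Set.Icc (μ q.2 - σ q.2) (μ q.2 - σ q.2 + σ q.2 / 2)} ∪
        {x : Fin T × Fin N → ℝ | ∀ j, x (q.1, j) ∉ Set.Icc (μ q.2 + σ q.2 / 2) (μ q.2 + σ q.2 / 2 + σ q.2 / 2)})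
        ≤ 2 * exp (-(N * (1 / (12 * M)))) := by
      intro q hq
      have hq' : 1 ≤ M * w q.2 := by simpa [I] using hq
      have hs := h.2.2 q.2
      refine le_trans (measureReal_union_le _ _) ?_
      have a1 := miss_prob (N := N) D _ measurableSet_Icc q.1 _
        (heavy_mass M w μ σ h q.2 hM hq' (μ q.2 - σ q.2) le_rfl (by linarith))
      have a2 := miss_prob (N := N) D _ measurableSet_Icc q.1 _
        (heavy_mass M w μ σ h q.2 hM hq' (μ q.2 + σ q.2 / 2) (by linarith) (by linarith))
      linarith
    refine le_trans (Finset.sum_le_sum hterm) ?_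
    rw [Finset.sum_const, nsmul_eq_mul]
    refine le_trans ?_ hT
    have hc : (I.card : ℝ) ≤ T * k := by
      have : I.card ≤ T * k := (Finset.card_filter_le _ _).trans (by simp)
      exact_mod_cast this
    calc (I.card : ℝ) * (2 * exp (-(N * (1 / (12 * M))))) ≤ T * k * (2 * exp (-(N * (1 / (12 * M))))) := by
          gcongr
      _ = _ := by ring
  have e1 := probReal_compl_eq_one_sub (μ := Measure.pi fun _ : Fin T × Fin N => D) hEm
  rw [ENNReal.ofReal_le_iff_le_toReal (measure_ne_top _ _)]
  have : (Measure.pi fun _ : Fin T × Fin N => D).real (goodEv T N M w μ σ) =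
    ((Measure.pi fun _ : Fin T × Fin N => D) (goodEv T N M w μ σ)).toReal := rfl
  linarith

lemma popular {k : ℕ} (T N M t m : ℕ) (w μ σ : Fin k → ℝ) (h : IsMixParams1 w σ) (hN : 1 ≤ N)
    (hm : 2 * (Nat.clog 2 N + 3) ≤ m) (hT : m * (2 * t) ≤ T) (hT1 : 1 ≤ T)
    (x : Fin T × Fin N → ℝ) (hx : x ∈ goodEv T N M w μ σ) (i : Fin k) (hi : 1 ≤ M * w i) :
    ∃ b ∈ bsupp (allVotes x), 2 * t ≤ bcount (allVotes x) b ∧ GoodBin N (μ i) (σ i) b := by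
  classical
  have hv : ∀ g : Fin T, ∃ v ∈ allVotes x g, GoodBin N (μ i) (σ i) v := by
    intro g
    obtain ⟨⟨a, ha⟩, ⟨b, hb⟩⟩ := hx g i hi
    exact exists_good_vote (fun j => x (g, j)) (μ i) (σ i) (h.2.2 i) a b ha.1 (by linarith [ha.2])
      hb.1 (by linarith [hb.2])
  choose f hf1 hf2 using hv
  obtain ⟨G, hG, hGm⟩ := good_finite N hN (μ i) (σ i) (h.2.2 i)
  have hmap : ∀ g ∈ (Finset.univ : Finset (Fin T)), f g ∈ G := fun g _ => hGm _ (hf2 g)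
  have hGn : G.Nonempty := ⟨f ⟨0, hT1⟩, hmap _ (Finset.mem_univ _)⟩
  obtain ⟨y, hy, hc⟩ := Finset.exists_le_card_fiber_of_mul_le_card_of_maps_to (n := 2 * t) hmap hGn (by
    rw [Finset.card_univ, Fintype.card_fin]
    exact le_trans (Nat.mul_le_mul_right _ (hG.trans hm)) hT)
  by_cases hfib : ∃ g, f g = y
  · obtain ⟨g, hg⟩ := hfib
    refine ⟨y, (mem_bsupp _ _).2 ⟨g, hg ▸ hf1 g⟩, hc.trans ?_, hg ▸ hf2 g⟩
    unfold bcount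
    apply Finset.card_le_card
    intro g' hg'
    simp only [Finset.mem_filter, Finset.mem_univ, true_and] at hg' ⊢
    rw [← hg']; exact hf1 g'
  · have ht : t = 0 := by
      have : (Finset.univ.filter (fun g => f g = y)) = ∅ := by
        apply Finset.filter_eq_empty_iff.2
        intro g _ hg
        exact hfib ⟨g, hg⟩
      rw [this] at hc
      simpa using hc
    refine ⟨f ⟨0, hT1⟩, (mem_bsupp _ _).2 ⟨_, hf1 _⟩, by simp [ht], hf2 _⟩

lemma grid_comp (N M : ℕ) (μ σ κ : ℝ) (b : ℤ × ℤ) (hb : GoodBin N μ σ b) (hσ : 0 < σ) (hN : 1 ≤ N)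
    (hκ0 : 0 < κ) (hκ : κ ≤ 1) (hM : 8 ≤ κ * M) :
    ∃ js < 12 * N * M + 2, ∃ jm < 12 * N * M + 2,
      σ * (1 + κ / 4) ≤ (js + 1 : ℝ) * (2:ℝ) ^ b.1 / M ∧
      (js + 1 : ℝ) * (2:ℝ) ^ b.1 / M ≤ σ * (1 + κ / 2) ∧
      |μ - (((b.2 : ℝ) - 1) * (4 * N * (2:ℝ) ^ b.1) + jm * (2:ℝ) ^ b.1 / M)| ≤ σ * κ / 4 := by
  obtain ⟨h1, h2, u, hu1, hu2, hu3⟩ := hb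
  set s : ℝ := (2:ℝ) ^ b.1 with hs
  have hs0 : 0 < s := by positivity
  have hNr : (1:ℝ) ≤ N := by exact_mod_cast hN
  have hM0 : (0:ℝ) < M := by
    rcases (Nat.cast_nonneg M : (0:ℝ) ≤ M).eq_or_lt with h | h
    · rw [← h] at hM; linarith
    · exact h
  have hM8 : (8:ℝ) ≤ M := by nlinarith
  set st := s / M with hst
  have hst0 : 0 < st := by positivity
  have hsM : st * M = s := by rw [hst]; field_simp
  have hstep : st ≤ σ * κ / 4 := by
    rw [hst, div_le_iff₀ hM0]
    nlinarith
  -- sigma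
  set y := σ * (1 + κ / 4) / st with hy
  have hy0 : 0 < y := by positivity
  have hyst : y * st = σ * (1 + κ / 4) := by rw [hy]; field_simp
  have hybound : y ≤ 4 * N * M := by
    rw [hy, div_le_iff₀ hst0]
    calc σ * (1 + κ / 4) ≤ (2 * N * s) * 2 := by
          apply mul_le_mul h1 (by linarith) (by positivity) (by positivity)
      _ = 4 * N * M * st := by rw [← hsM]; ring
  have hc1 : 1 ≤ ⌈y⌉₊ := Nat.one_le_ceil_iff.2 hy0
  have hc2 := Nat.le_ceil y
  have hc3 := Nat.ceil_lt_add_one hy0.le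
  -- mu
  set W := 4 * N * s with hW
  have hW0 : 0 < W := by positivity
  have hl1 : (b.2 : ℝ) * W ≤ u := by
    rw [hu3, ← le_div_iff₀ hW0]; exact Int.floor_le _
  have hl2 : u < ((b.2 : ℝ) + 1) * W := by
    rw [hu3, ← div_lt_iff₀ hW0]; exact Int.lt_floor_add_one _
  have hσW : 2 * σ ≤ W := by rw [hW]; linarith
  set z := (μ - ((b.2 : ℝ) - 1) * W) / st with hz
  have hz0 : 0 ≤ z := by
    apply div_nonneg _ hst0.le
    nlinarith
  have hzst : z * st = μ - ((b.2 : ℝ) - 1) * W := by rw [hz]; field_simp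
  have hzb : z ≤ 10 * N * M := by
    rw [hz, div_le_iff₀ hst0]
    calc μ - ((b.2 : ℝ) - 1) * W ≤ 5 / 2 * W := by nlinarith
      _ = 10 * N * M * st := by rw [hW, ← hsM]; ring
  have hf1 := Nat.floor_le hz0
  have hf2 := Nat.lt_floor_add_one z
  have hNM : (0:ℝ) ≤ N * M := by positivity
  refine ⟨⌈y⌉₊ - 1, ?_, ⌊z⌋₊, ?_, ?_, ?_, ?_⟩
  · have : (⌈y⌉₊ : ℝ) < 12 * N * M + 2 := by nlinarith
    have : ⌈y⌉₊ < 12 * N * M + 2 := by exact_mod_cast this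
    omega
  · have : (⌊z⌋₊ : ℝ) < 12 * N * M + 2 := by nlinarith
    exact_mod_cast this
  · rw [Nat.cast_sub hc1, mul_div_assoc, ← hst, ← hyst]
    push_cast
    nlinarith
  · rw [Nat.cast_sub hc1, mul_div_assoc, ← hst]
    push_cast
    nlinarith
  · rw [mul_div_assoc, ← hst]
    rw [show μ - (((b.2 : ℝ) - 1) * W + ⌊z⌋₊ * st) = (z - ⌊z⌋₊) * st by linear_combination -hzst]
    rw [abs_of_nonneg (mul_nonneg (by linarith) hst0.le)]
    nlinarith

lemma round_weights {k : ℕ} (w : Fin k → ℝ) (hw : ∀ i, 0 ≤ w i) (hs : ∑ i, w i = 1) (M : ℕ) :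
    ∃ c : Fin k → ℕ, ∑ i, c i = M ∧ ∀ i, M * w i - 1 ≤ c i := by
  classical
  have hk : 0 < k := by
    rcases Nat.eq_zero_or_pos k with rfl | h
    · simp at hs
    · exact h
  have hsum : ∑ i, ⌊M * w i⌋₊ ≤ M := by
    have : ((∑ i, ⌊M * w i⌋₊ : ℕ) : ℝ) ≤ M := by
      push_cast
      calc ∑ i, (⌊M * w i⌋₊ : ℝ) ≤ ∑ i, M * w i :=
            Finset.sum_le_sum fun i _ => Nat.floor_le (mul_nonneg (Nat.cast_nonneg _) (hw i))
        _ = M := by rw [← Finset.mul_sum, hs, mul_one]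
    exact_mod_cast this
  refine ⟨fun i => ⌊M * w i⌋₊ + if i = ⟨0, hk⟩ then M - ∑ i, ⌊M * w i⌋₊ else 0, ?_, ?_⟩
  · rw [Finset.sum_add_distrib, Finset.sum_ite_eq']
    simp only [Finset.mem_univ, if_true]
    omega
  · intro i
    have := Nat.lt_floor_add_one ((M:ℝ) * w i)
    push_cast
    have h2 : (0:ℝ) ≤ ((if i = ⟨0, hk⟩ then M - ∑ i, ⌊M * w i⌋₊ else 0 : ℕ) : ℝ) := Nat.cast_nonneg _
    push_cast at h2
    linarith


/-- The output type: weights, means, standard deviations. -/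
abbrev Pm (k : ℕ) := (Fin k → ℝ) × (Fin k → ℝ) × (Fin k → ℝ)

/-- The mixture of a parameter triple. -/
def mixP (k : ℕ) (p : Pm k) : Measure ℝ := mixture1 k p.1 p.2.1 p.2.2

/-- Decoding a discrete description of a mixture. -/
def decP (k N M : ℕ) (f : Fin k → (ℤ × ℤ) × ℕ × ℕ × ℕ) : Pm k :=
  (fun i => ((f i).2.2.2 : ℝ) / M,
   fun i => (((f i).1.2 : ℝ) - 1) * (4 * N * (2:ℝ) ^ (f i).1.1) + (f i).2.2.1 * (2:ℝ) ^ (f i).1.1 / M,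
   fun i => (((f i).2.1 : ℝ) + 1) * (2:ℝ) ^ (f i).1.1 / M)

/-- The discrete descriptions. -/
def codes (k N M : ℕ) (R : Finset (ℤ × ℤ)) : Finset (Fin k → (ℤ × ℤ) × ℕ × ℕ × ℕ) :=
  (Fintype.piFinset (fun _ : Fin k => R ×ˢ Finset.range (12 * N * M + 2) ×ˢ
    Finset.range (12 * N * M + 2) ×ˢ Finset.range (M + 1))).filter (fun f => ∑ i, (f i).2.2.2 = M)

open Classical in
/-- The hypotheses. -/
def hyps (k N M : ℕ) (R : Finset (ℤ × ℤ)) : Finset (Pm k) := (codes k N M R).image (decP k N M)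

lemma card_hyps (k N M : ℕ) (R : Finset (ℤ × ℤ)) :
    (hyps k N M R).card ≤ (R.card * ((12 * N * M + 2) * ((12 * N * M + 2) * (M + 1)))) ^ k := by
  classical
  unfold hyps codes
  refine Finset.card_image_le.trans ((Finset.card_filter_le _ _).trans ?_)
  rw [Fintype.card_piFinset]
  simp [Finset.card_product]

lemma hyps_valid (k N M : ℕ) (hM : 0 < M) (R : Finset (ℤ × ℤ)) (p : Pm k) (hp : p ∈ hyps k N M R) :
    IsMixParams1 p.1 p.2.2 := by
  classical
  unfold hyps at hp
  obtain ⟨f, hf, rfl⟩ := Finset.mem_image.1 hp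
  have hMr : (0:ℝ) < M := by exact_mod_cast hM
  have hsum : ∑ i, (f i).2.2.2 = M := (Finset.mem_filter.1 hf).2
  refine ⟨fun i => by simp only [decP]; positivity, ?_, fun i => by simp only [decP]; positivity⟩
  simp only [decP]
  rw [← Finset.sum_div, ← Nat.cast_sum, hsum, div_self hMr.ne']

lemma hyps_approx (k N M : ℕ) (α : ℝ) (hα : 0 < α) (hα1 : α < 1) (hN : 1 ≤ N) (hkM : k ≤ M)
    (hM1 : 160 ≤ α * M) (hM2 : 20 * k ≤ α * M) (R : Finset (ℤ × ℤ)) (w μ σ : Fin k → ℝ)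
    (h : IsMixParams1 w σ)
    (hR : ∀ i, 1 ≤ M * w i → ∃ b ∈ R, GoodBin N (μ i) (σ i) b) :
    ∃ p ∈ hyps k N M R, TV (mixP k p) (mixture1 k w μ σ) ≤ α / 10 := by
  classical
  have hM0 : (0:ℝ) < M := by
    rcases (Nat.cast_nonneg M : (0:ℝ) ≤ M).eq_or_lt with h | h
    · rw [← h] at hM1; linarith
    · exact h
  have hMn : 0 < M := by exact_mod_cast hM0
  -- some heavy component
  have hheavy : ∃ i, 1 ≤ M * w i := by
    by_contra hcon
    push Not at hcon
    have h1 : ∑ i, M * w i = M := by rw [← Finset.mul_sum, h.2.1, mul_one]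
    have hkM' : (k:ℝ) ≤ M := by exact_mod_cast hkM
    rcases Nat.eq_zero_or_pos k with rfl | hk
    · have := h.2.1; simp at this
    · have h2 : ∑ i : Fin k, M * w i < ∑ i : Fin k, (1:ℝ) :=
        Finset.sum_lt_sum_of_nonempty ⟨⟨0, hk⟩, Finset.mem_univ _⟩ fun i _ => hcon i
      simp at h2
      linarith
  obtain ⟨i0, hi0⟩ := hheavy
  obtain ⟨b0, hb0, -⟩ := hR i0 hi0
  obtain ⟨c, hc, hcw⟩ := round_weights w h.1 h.2.1 M
  have hsel : ∀ i, ∃ q : (ℤ × ℤ) × ℕ × ℕ, q.1 ∈ R ∧ q.2.1 < 12 * N * M + 2 ∧ q.2.2 < 12 * N * M + 2 ∧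
      (1 ≤ M * w i → σ i * (1 + (α / 20) / 4) ≤ (q.2.1 + 1 : ℝ) * (2:ℝ) ^ q.1.1 / M ∧
      (q.2.1 + 1 : ℝ) * (2:ℝ) ^ q.1.1 / M ≤ σ i * (1 + (α / 20) / 2) ∧
      |μ i - (((q.1.2 : ℝ) - 1) * (4 * N * (2:ℝ) ^ q.1.1) + q.2.2 * (2:ℝ) ^ q.1.1 / M)| ≤
        σ i * (α / 20) / 4) := by
    intro i
    by_cases hi : 1 ≤ M * w i
    · obtain ⟨b, hb, hgb⟩ := hR i hi
      obtain ⟨js, hjs, jm, hjm, g1, g2, g3⟩ := grid_comp N M (μ i) (σ i) (α / 20) b hgb (h.2.2 i) hN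
        (by linarith) (by linarith) (by linarith)
      exact ⟨(b, js, jm), hb, hjs, hjm, fun _ => ⟨g1, g2, g3⟩⟩
    · exact ⟨(b0, 0, 0), hb0, Nat.succ_pos _, Nat.succ_pos _, fun h => absurd h hi⟩
  choose q hq1 hq2 hq3 hq4 using hsel
  let f : Fin k → (ℤ × ℤ) × ℕ × ℕ × ℕ := fun i => ((q i).1, (q i).2.1, (q i).2.2, c i)
  have hmain := mixture_approx w μ σ h M (α / 20) (by linarith) (by linarith) hMn c hc hcw
    (decP k N M f).2.1 (decP k N M f).2.2 (fun i => by simp only [decP]; positivity) (fun i hi => hq4 i hi)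
  refine ⟨decP k N M f, ?_, ?_⟩
  · unfold hyps codes
    refine Finset.mem_image_of_mem _ (Finset.mem_filter.2 ⟨?_, hc⟩)
    rw [Fintype.mem_piFinset]
    intro i
    simp only [Finset.mem_product, Finset.mem_range, f]
    refine ⟨hq1 i, hq2 i, hq3 i, ?_⟩
    have : c i ≤ ∑ i, c i := Finset.single_le_sum (fun _ _ => Nat.zero_le _) (Finset.mem_univ i)
    omega
  · refine le_trans hmain.2 ?_
    have : (k:ℝ) / M ≤ α / 20 := by rw [div_le_iff₀ hM0]; linarith
    linarith

lemma card_bsupp {T N : ℕ} (x : Fin T × Fin N → ℝ) : (bsupp (allVotes x)).card ≤ T * (N * N) := by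
  unfold bsupp
  have h := @Finset.card_biUnion_le_card_mul _ _ (fun a b => Classical.propDecidable (a = b))
    (Finset.univ : Finset (Fin T)) (allVotes x) (N * N) (fun g _ => card_votes _)
  simpa using h

/-- Bound on the number of hypotheses. -/
def hbd (k N M T : ℕ) : ℕ :=
  (T * (N * N) * ((12 * N * M + 2) * ((12 * N * M + 2) * (M + 1)))) ^ k

theorem core (k M N T t m n2 n : ℕ) (α ε δ d : ℝ) (hα : 0 < α) (hα1 : α < 1) (hε : 0 < ε)
    (hN : 1 ≤ N) (hkM : k ≤ M) (hM1 : 160 ≤ α * M) (hM2 : 20 * k ≤ α * M) (ht : 1 ≤ t)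
    (hm : 2 * (Nat.clog 2 N + 3) ≤ m) (hT : m * (2 * t) ≤ T) (hd : 0 ≤ d)
    (htd : exp (-(ε / 6 * (t - 1))) ≤ d) (hd6 : 6 * exp ε * (2 * d) ≤ δ)
    (hE : 2 * k * T * exp (-(N * (1 / (12 * M)))) ≤ 1 / 100) (hn : n = T * N + n2)
    (hc1 : hbd k N M T * exp (-(ε * α * n2 / 10)) ≤ 1 / 100)
    (hc2 : 2 * (hbd k N M T : ℝ) ^ 2 * exp (-(n2 * α ^ 2 / 50)) ≤ 1 / 100) :
    ∃ K : Kernel (Fin n → ℝ) (Pm k), IsMarkovKernel K ∧ IsDP K ε δ ∧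
      ∀ w μ σ : Fin k → ℝ, IsMixParams1 w σ →
        ENNReal.ofReal (97 / 100) ≤ ((Measure.pi fun _ : Fin n => mixture1 k w μ σ).bind fun x => K x)
          {p : Pm k | IsMixParams1 p.1 p.2.2 ∧ TV (mixture1 k p.1 p.2.1 p.2.2) (mixture1 k w μ σ) ≤ α} := by
  classical
  have hM0 : 0 < M := by
    rcases Nat.eq_zero_or_pos M with rfl | h
    · simp at hM1; linarith
    · exact h
  have hT1 : 1 ≤ T := by
    have : 1 ≤ m := by omega
    have : 1 ≤ m * (2 * t) := Nat.one_le_iff_ne_zero.2 (by positivity)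
    omega
  have hK2 : ∀ R : Finset (ℤ × ℤ), ∃ K : Kernel (Fin n2 → ℝ) (Pm k), IsMarkovKernel K ∧
      (∀ x x', Adjacent x x' → ∀ O, MeasurableSet O → K x' O ≤ ENNReal.ofReal (exp ε) * K x O) ∧
      ∀ (D : Measure ℝ) [IsProbabilityMeasure D],
        (hyps k N M R).card * exp (-(ε * α * n2 / 10)) ≤ 1 / 100 →
        2 * ((hyps k N M R).card : ℝ) ^ 2 * exp (-(n2 * α ^ 2 / 50)) ≤ 1 / 100 →
        (∃ h ∈ hyps k N M R, TV (mixP k h) D ≤ α / 10) →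
        ENNReal.ofReal (98 / 100) ≤ ∫⁻ x, K x {h | h ∈ hyps k N M R ∧ TV (mixP k h) D ≤ α}
          ∂(Measure.pi fun _ : Fin n2 => D) := by
    intro R
    by_cases hR : (hyps k N M R).Nonempty
    · exact phase2 (hyps k N M R) hR (mixP k)
        (fun p hp => mixture1_prob _ _ _ (hyps_valid k N M hM0 R p hp)) n2 α ε hα hε
    · refine ⟨Kernel.const _ (Measure.dirac 0), inferInstance, ?_, ?_⟩
      · intro x x' _ O _
        simp only [Kernel.const_apply]
        have h1 : 1 ≤ ENNReal.ofReal (exp ε) := by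
          rw [← ENNReal.ofReal_one]; exact ENNReal.ofReal_le_ofReal (one_le_exp hε.le)
        calc Measure.dirac (0 : Pm k) O = 1 * Measure.dirac (0 : Pm k) O := (one_mul _).symm
          _ ≤ _ := by gcongr
      · rintro D _ _ _ ⟨h, hh, _⟩
        exact absurd ⟨h, hh⟩ hR
  choose K2 hK2m hK2dp hK2u using hK2
  have eq : (Fin T × Fin N) ⊕ Fin n2 ≃ Fin n :=
    ((Equiv.sumCongr finProdFinEquiv (Equiv.refl _)).trans finSumFinEquiv).trans (finCongr hn.symm)
  obtain ⟨K, hKm, hKdp, hKu⟩ := mech eq K2 hK2m ε δ (ε / 6) d t hε hK2dp (by linarith) hd ht htd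
    (by ring) hd6
  refine ⟨K, hKm, hKdp, ?_⟩
  intro w μ σ h
  have hDp := mixture1_prob w μ σ h
  set D := mixture1 k w μ σ with hD
  let S : Set (Pm k) := (⋃ R : Finset (ℤ × ℤ), (hyps k N M R : Set (Pm k))) ∩ {p | TV (mixP k p) D ≤ α}
  have hSm : MeasurableSet S := by
    apply Set.Countable.measurableSet
    refine Set.Countable.mono Set.inter_subset_left ?_
    exact Set.countable_iUnion fun R => (hyps k N M R).countable_toSet
  have hSsub : S ⊆ {p : Pm k | IsMixParams1 p.1 p.2.2 ∧ TV (mixture1 k p.1 p.2.1 p.2.2) D ≤ α} := by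
    rintro p ⟨hp1, hp2⟩
    obtain ⟨R, hR⟩ := Set.mem_iUnion.1 hp1
    exact ⟨hyps_valid k N M hM0 R p hR, hp2⟩
  refine le_trans ?_ (measure_mono hSsub)
  rw [Measure.bind_apply hSm K.measurable.aemeasurable]
  refine hKu D S hSm (goodEv T N M w μ σ) (measurableSet_goodEv T N M w μ σ)
    (goodEv_prob T N M w μ σ h hM0 hE) ?_
  intro x1 hx1 R hR1 hR2
  have hcard : (hyps k N M R).card ≤ hbd k N M T := by
    refine (card_hyps k N M R).trans ?_
    unfold hbd
    apply Nat.pow_le_pow_left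
    apply Nat.mul_le_mul_right
    exact (Finset.card_le_card hR1).trans (card_bsupp x1)
  have hcard' : ((hyps k N M R).card : ℝ) ≤ hbd k N M T := by exact_mod_cast hcard
  have happ := hyps_approx k N M α hα hα1 hN hkM hM1 hM2 R w μ σ h (fun i hi => by
    obtain ⟨b, hb, hbc, hbg⟩ := popular T N M t m w μ σ h hN hm hT hT1 x1 hx1 i hi
    exact ⟨b, hR2 b hb hbc, hbg⟩)
  refine le_trans (hK2u R D (le_trans ?_ hc1) (le_trans ?_ hc2) happ) ?_
  · gcongr
  · gcongr
  · refine lintegral_mono fun x2 => measure_mono ?_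
    rintro p ⟨hp1, hp2⟩
    exact ⟨Set.mem_iUnion.2 ⟨R, hp1⟩, hp2⟩


lemma pow_abs3 (Q : ℝ) (hQ : 3 ≤ Q) (a : ℕ) : (3:ℝ) ^ a ≤ Q ^ a := pow_le_pow_left₀ (by norm_num) hQ a

lemma clog_bound (N : ℕ) (hN : 1 ≤ N) (L : ℝ) (hL : 1 ≤ L) (h : log N ≤ 12 * L) :
    (2 * (Nat.clog 2 N + 3) : ℕ) ≤ 100 * L := by
  have hl2 := Real.log_two_gt_d9
  by_cases h0 : Nat.clog 2 N = 0
  · rw [h0]; push_cast; linarith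
  have hN1 : 1 < N := by
    by_contra hcon
    have : N = 1 := by omega
    subst this; simp at h0
  have h1 := Nat.pow_pred_clog_lt_self (b := 2) (by norm_num) hN1
  have h2 : ((2:ℝ) ^ (Nat.clog 2 N).pred) ≤ N := by exact_mod_cast h1.le
  have h3 := Real.log_le_log (by positivity) h2
  rw [Real.log_pow] at h3
  have h4 : ((Nat.clog 2 N).pred : ℝ) = Nat.clog 2 N - 1 := by
    rw [Nat.pred_eq_sub_one, Nat.cast_sub (by omega)]; simp
  rw [h4] at h3
  push_cast
  nlinarith

set_option maxHeartbeats 4000000 in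
theorem main_lemma (k n : ℕ) (hk : 1 ≤ k) (α ε δ : ℝ) (hα : 0 < α) (hα1 : α < 1) (hε : 0 < ε)
    (hε1 : ε < 1) (hδ : 0 < δ) (hδ1 : δ < 1)
    (hn : 300000000 * Real.log (2 + (k : ℝ) / (α * ε * δ)) ^ 3 *
      ((k : ℝ) / α ^ 2 + (k : ℝ) / (α * ε)) ≤ n) :
    ∃ K : Kernel (Fin n → ℝ) (Pm k), IsMarkovKernel K ∧ IsDP K ε δ ∧
      ∀ w μ σ : Fin k → ℝ, IsMixParams1 w σ →
        ENNReal.ofReal (97 / 100) ≤ ((Measure.pi fun _ : Fin n => mixture1 k w μ σ).bind fun x => K x)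
          {p : Pm k | IsMixParams1 p.1 p.2.2 ∧ TV (mixture1 k p.1 p.2.1 p.2.2) (mixture1 k w μ σ) ≤ α} := by
  set Q : ℝ := 2 + (k : ℝ) / (α * ε * δ) with hQdef
  set L := Real.log Q with hLdef
  have hkr : (1:ℝ) ≤ k := by exact_mod_cast hk
  have hαε : α * ε ≤ 1 := by nlinarith
  have hp : 0 < α * ε * δ := by positivity
  have hple : α * ε * δ ≤ 1 := by nlinarith
  -- basic comparisons with Q
  have hQk : (k:ℝ) / α ≤ Q := by
    have : (k:ℝ) / α ≤ k / (α * ε * δ) := by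
      apply div_le_div_of_nonneg_left (by linarith) hp
      nlinarith [mul_pos hα hε]
    linarith
  have hka : (k:ℝ) ≤ k / α := by rw [le_div_iff₀ hα]; nlinarith
  have hQε : 1 / ε ≤ Q := by
    have : 1 / ε ≤ k / (α * ε * δ) := by
      rw [div_le_div_iff₀ hε hp]
      nlinarith [mul_pos hα hε, mul_pos hα hδ, mul_pos (mul_pos hα hε) hδ]
    linarith
  have hQδ : 1 / δ ≤ Q := by
    have : 1 / δ ≤ k / (α * ε * δ) := by
      rw [div_le_div_iff₀ hδ hp]
      nlinarith [mul_pos hα hε, mul_pos hα hδ, mul_pos (mul_pos hα hε) hδ]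
    linarith
  have hQ3 : 3 ≤ Q := by
    have : 1 ≤ (k:ℝ) / (α * ε * δ) := by rw [le_div_iff₀ hp]; linarith
    linarith
  have hQ0 : 0 < Q := by linarith
  have hQ1 : 1 ≤ Q := by linarith
  have hL1 : 1 ≤ L := by
    rw [hLdef, Real.le_log_iff_exp_le hQ0]
    have := Real.exp_one_lt_d9
    linarith
  have hLQ : L ≤ Q := (Real.log_le_sub_one_of_pos hQ0).trans (by linarith)
  have hε' : 1 ≤ 1 / ε := by rw [le_div_iff₀ hε]; linarith
  have hkα1 : 1 ≤ (k:ℝ) / α := hkr.trans hka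
  have hQL : Q = exp L := (Real.exp_log hQ0).symm
  clear_value L
  clear_value Q
  -- M
  obtain ⟨M, hM⟩ : ∃ M : ℕ, M = ⌈160 * (k:ℝ) / α⌉₊ := ⟨_, rfl⟩
  have hMlo : 160 * (k:ℝ) / α ≤ M := hM ▸ Nat.le_ceil _
  have hMhi : (M:ℝ) ≤ 161 * (k / α) := by
    have := Nat.ceil_lt_add_one (show 0 ≤ 160 * (k:ℝ) / α by positivity)
    rw [← hM] at this
    have e : 160 * (k:ℝ) / α = 160 * (k / α) := by ring
    rw [e] at this
    linarith
  have hMα : 160 * (k:ℝ) ≤ α * M := by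
    rw [div_le_iff₀ hα] at hMlo; linarith
  have hMk : (k:ℝ) ≤ M := by
    have e : 160 * (k:ℝ) / α = 160 * (k / α) := by ring
    rw [e] at hMlo
    linarith only [hMlo, hka, hkr]
  have hM1 : (1:ℝ) ≤ M := hkr.trans hMk
  have hMQ : (M:ℝ) ≤ Q ^ 6 := by
    have h := pow_abs3 Q hQ3 5
    calc (M:ℝ) ≤ 161 * Q := by linarith
      _ ≤ Q ^ 5 * Q := by gcongr; norm_num at h; linarith
      _ = Q ^ 6 := by ring
  -- t
  obtain ⟨t0, ht0⟩ : ∃ t0 : ℕ, t0 = ⌈6 / ε * Real.log (36 / δ)⌉₊ := ⟨_, rfl⟩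
  have hlogδ0 : 0 ≤ Real.log (36 / δ) := by
    apply Real.log_nonneg; rw [le_div_iff₀ hδ]; linarith
  have hlogδ : Real.log (36 / δ) ≤ 5 * L := by
    have h := pow_abs3 Q hQ3 4
    have : 36 / δ ≤ Q ^ 5 := by
      calc 36 / δ = 36 * (1 / δ) := by ring
        _ ≤ Q ^ 4 * Q := by
          apply mul_le_mul _ hQδ (by positivity) (by positivity)
          norm_num at h; linarith
        _ = Q ^ 5 := by ring
    have h2 := Real.log_le_log (by positivity) this
    rw [Real.log_pow, ← hLdef] at h2
    exact_mod_cast h2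
  have ht0lo : 6 / ε * Real.log (36 / δ) ≤ t0 := ht0 ▸ Nat.le_ceil _
  have ht0hi : (t0:ℝ) ≤ 31 * (L * (1 / ε)) := by
    have := Nat.ceil_lt_add_one (show 0 ≤ 6 / ε * Real.log (36 / δ) by positivity)
    rw [← ht0] at this
    have e : 6 / ε * Real.log (36 / δ) ≤ 30 * (L * (1 / ε)) := by
      calc 6 / ε * Real.log (36 / δ) ≤ 6 / ε * (5 * L) := by gcongr
        _ = _ := by ring
    have : 1 ≤ L * (1 / ε) := one_le_mul_of_one_le_of_one_le hL1 hε'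
    linarith
  have hLε1 : 1 ≤ L * (1 / ε) := one_le_mul_of_one_le_of_one_le hL1 hε'
  -- m
  obtain ⟨m, hm⟩ : ∃ m : ℕ, m = ⌈100 * L⌉₊ := ⟨_, rfl⟩
  have hmlo : 100 * L ≤ m := hm ▸ Nat.le_ceil _
  have hmhi : (m:ℝ) ≤ 101 * L := by
    have := Nat.ceil_lt_add_one (show 0 ≤ 100 * L by positivity)
    rw [← hm] at this
    linarith
  -- T
  obtain ⟨T, hT⟩ : ∃ T : ℕ, T = m * (2 * (t0 + 1)) := ⟨_, rfl⟩
  have hThi : (T:ℝ) ≤ 6464 * (L ^ 2 * (1 / ε)) := by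
    rw [hT]; push_cast
    have h1 : 2 * ((t0:ℝ) + 1) ≤ 64 * (L * (1 / ε)) := by linarith
    calc (m:ℝ) * (2 * (t0 + 1)) ≤ (101 * L) * (64 * (L * (1 / ε))) :=
          mul_le_mul hmhi h1 (by positivity) (by positivity)
      _ = _ := by ring
  have hTQ : (T:ℝ) ≤ Q ^ 11 := by
    have h := pow_abs3 Q hQ3 8
    calc (T:ℝ) ≤ 6464 * (L ^ 2 * (1 / ε)) := hThi
      _ ≤ Q ^ 8 * (Q ^ 2 * Q) := by gcongr; norm_num at h; linarith
      _ = Q ^ 11 := by ring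
  have hT1 : (1:ℝ) ≤ T := by
    have : 1 ≤ T := by
      rw [hT]
      have : m ≠ 0 := by
        rintro rfl
        simp at hmlo; linarith
      exact Nat.one_le_iff_ne_zero.2 (by positivity)
    exact_mod_cast this
  -- N
  obtain ⟨N, hN⟩ : ∃ N : ℕ, N = ⌈12 * M * Real.log (200 * k * T)⌉₊ := ⟨_, rfl⟩
  have hkT1 : 1 ≤ (k:ℝ) * T := one_le_mul_of_one_le_of_one_le hkr hT1
  have hlogT1 : 1 ≤ Real.log (200 * k * T) := by
    rw [Real.le_log_iff_exp_le (by positivity)]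
    have := Real.exp_one_lt_d9
    linarith
  have hlogT : Real.log (200 * k * T) ≤ 17 * L := by
    have h := pow_abs3 Q hQ3 5
    have : 200 * k * T ≤ Q ^ 17 := by
      calc 200 * (k:ℝ) * T ≤ Q ^ 5 * Q * Q ^ 11 := by
            gcongr
            · norm_num at h; linarith
            · linarith
        _ = Q ^ 17 := by ring
    have h2 := Real.log_le_log (by positivity) this
    rw [Real.log_pow, ← hLdef] at h2
    exact_mod_cast h2
  have hNlo : 12 * M * Real.log (200 * k * T) ≤ N := hN ▸ Nat.le_ceil _
  have hNhi : (N:ℝ) ≤ 33005 * ((k / α) * L) := by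
    have h0 := Nat.ceil_lt_add_one (show 0 ≤ 12 * M * Real.log (200 * k * T) by positivity)
    rw [← hN] at h0
    have h1 : 12 * M * Real.log (200 * k * T) ≤ 12 * M * (17 * L) := by gcongr
    have h2 : (N:ℝ) ≤ 205 * (M * L) := by
      have : 1 ≤ (M:ℝ) * L := one_le_mul_of_one_le_of_one_le hM1 hL1
      linarith
    calc (N:ℝ) ≤ 205 * (M * L) := h2
      _ ≤ 205 * ((161 * (k / α)) * L) := by gcongr
      _ = _ := by ring
  have hNQ : (N:ℝ) ≤ Q ^ 12 := by
    have h := pow_abs3 Q hQ3 10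
    calc (N:ℝ) ≤ 33005 * ((k / α) * L) := hNhi
      _ ≤ Q ^ 10 * (Q * Q) := by gcongr; norm_num at h; linarith
      _ = Q ^ 12 := by ring
  have hN1r : (1:ℝ) ≤ N := by
    have := one_le_mul_of_one_le_of_one_le hM1 hlogT1
    linarith
  have hN1 : 1 ≤ N := by exact_mod_cast hN1r
  have hlogN : Real.log N ≤ 12 * L := by
    have h2 := Real.log_le_log (by linarith) hNQ
    rw [Real.log_pow, ← hLdef] at h2
    exact_mod_cast h2
  have hTN : (T:ℝ) * N ≤ 214000000 * (L ^ 3 * (k / (α * ε))) := by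
    calc (T:ℝ) * N ≤ (6464 * (L ^ 2 * (1 / ε))) * (33005 * ((k / α) * L)) :=
          mul_le_mul hThi hNhi (by linarith) (by positivity)
      _ = 213344320 * (L ^ 3 * (k / (α * ε))) := by field_simp; ring
      _ ≤ _ := by
        have : 0 ≤ L ^ 3 * (k / (α * ε)) := by positivity
        linarith
  have hA0 : 0 ≤ L ^ 3 * ((k:ℝ) / α ^ 2) := by positivity
  have hB0 : 0 ≤ L ^ 3 * ((k:ℝ) / (α * ε)) := by positivity
  have hn' : 300000000 * (L ^ 3 * ((k:ℝ) / α ^ 2)) + 300000000 * (L ^ 3 * ((k:ℝ) / (α * ε))) ≤ n := by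
    refine le_trans (le_of_eq ?_) hn; ring
  have hTNn : T * N ≤ n := by
    have : ((T * N : ℕ) : ℝ) ≤ n := by push_cast; linarith
    exact_mod_cast this
  obtain ⟨n2, hn2⟩ : ∃ n2 : ℕ, n = T * N + n2 := ⟨n - T * N, by omega⟩
  have hn2r : (n:ℝ) = T * N + n2 := by rw [hn2]; push_cast; ring
  have hn2a : 80000000 * (L ^ 3 * ((k:ℝ) / α ^ 2)) ≤ n2 := by linarith
  have hn2b : 80000000 * (L ^ 3 * ((k:ℝ) / (α * ε))) ≤ n2 := by linarith
  have hL3 : L ≤ L ^ 3 := le_self_pow₀ hL1 (by norm_num)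
  have hkL1 : 1 ≤ k * L := one_le_mul_of_one_le_of_one_le hkr hL1
  -- hbd
  have hbdQ : (hbd k N M T : ℝ) ≤ exp (84 * (k * L)) := by
    have hJ : 12 * (N:ℝ) * M + 2 ≤ Q ^ 21 := by
      have h := pow_abs3 Q hQ3 3
      have h1 : (1:ℝ) ≤ Q ^ 12 * Q ^ 6 := by
        have a := one_le_pow₀ (n := 12) hQ1
        have b := one_le_pow₀ (n := 6) hQ1
        exact one_le_mul_of_one_le_of_one_le a b
      calc 12 * (N:ℝ) * M + 2 ≤ 12 * Q ^ 12 * Q ^ 6 + 2 * (Q ^ 12 * Q ^ 6) := by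
            have : 12 * (N:ℝ) * M ≤ 12 * Q ^ 12 * Q ^ 6 := by gcongr
            linarith
        _ = 14 * (Q ^ 12 * Q ^ 6) := by ring
        _ ≤ Q ^ 3 * (Q ^ 12 * Q ^ 6) := by gcongr; norm_num at h; linarith
        _ = Q ^ 21 := by ring
    have hM' : (M:ℝ) + 1 ≤ Q ^ 7 := by
      have b := one_le_pow₀ (n := 6) hQ1
      calc (M:ℝ) + 1 ≤ 2 * Q ^ 6 := by linarith
        _ ≤ Q * Q ^ 6 := by gcongr; linarith
        _ = Q ^ 7 := by ring
    have hbase : (T:ℝ) * (N * N) * ((12 * N * M + 2) * ((12 * N * M + 2) * (M + 1))) ≤ Q ^ 84 := by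
      calc (T:ℝ) * (N * N) * ((12 * N * M + 2) * ((12 * N * M + 2) * (M + 1)))
          ≤ Q ^ 11 * (Q ^ 12 * Q ^ 12) * (Q ^ 21 * (Q ^ 21 * Q ^ 7)) := by gcongr
        _ = Q ^ 84 := by ring
    unfold hbd
    push_cast
    calc ((T:ℝ) * (N * N) * ((12 * N * M + 2) * ((12 * N * M + 2) * (M + 1)))) ^ k ≤ (Q ^ 84) ^ k := by
          gcongr
      _ = exp (84 * (k * L)) := by
          rw [hQL, ← exp_nat_mul, ← exp_nat_mul]
          push_cast; ring_nf
  have hbd0 : (0:ℝ) ≤ hbd k N M T := Nat.cast_nonneg _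
  have he5 : exp (-5) ≤ 1 / 200 * 2 := by
    have h1 : (2.7:ℝ) ≤ exp 1 := by have := Real.exp_one_gt_d9; linarith
    have h2 : (2.7:ℝ) ^ 5 ≤ exp 5 := by
      have : exp 5 = exp 1 ^ 5 := by rw [← exp_nat_mul]; norm_num
      rw [this]; gcongr
    rw [Real.exp_neg, inv_le_comm₀ (exp_pos _) (by norm_num)]
    norm_num at h2 ⊢; linarith
  have he6 : exp (-6) ≤ 1 / 200 := by
    have h1 : (2.7:ℝ) ≤ exp 1 := by have := Real.exp_one_gt_d9; linarith
    have h2 : (2.7:ℝ) ^ 6 ≤ exp 6 := by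
      have : exp 6 = exp 1 ^ 6 := by rw [← exp_nat_mul]; norm_num
      rw [this]; gcongr
    rw [Real.exp_neg, inv_le_comm₀ (exp_pos _) (by norm_num)]
    norm_num at h2 ⊢; linarith
  refine core k M N T (t0 + 1) m n2 n α ε δ (δ / 36) hα hα1 hε hN1 (by exact_mod_cast hMk)
    (by linarith) (by linarith) (by omega) ?_ hT.ge (by linarith) ?_ ?_ ?_ hn2 ?_ ?_
  · have := clog_bound N hN1 L hL1 hlogN
    have h2 := this.trans hmlo
    exact_mod_cast h2
  · push_cast
    have h1 : -(ε / 6 * ((t0:ℝ) + 1 - 1)) ≤ Real.log (δ / 36) := by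
      have e : Real.log (δ / 36) = - Real.log (36 / δ) := by rw [← Real.log_inv]; congr 1; rw [inv_div]
      rw [e]
      have : Real.log (36 / δ) ≤ ε / 6 * t0 := by
        calc Real.log (36 / δ) = ε / 6 * (6 / ε * Real.log (36 / δ)) := by field_simp
          _ ≤ _ := by gcongr
      linarith
    calc _ ≤ exp (Real.log (δ / 36)) := exp_le_exp.2 h1
      _ = δ / 36 := Real.exp_log (by positivity)
  · have h1 : exp ε ≤ exp 1 := exp_le_exp.2 hε1.le
    have := Real.exp_one_lt_d9
    nlinarith
  · have hM0 : (0:ℝ) < M := by linarith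
    have h1 : -((N:ℝ) * (1 / (12 * M))) ≤ - Real.log (200 * k * T) := by
      have : Real.log (200 * k * T) ≤ (N:ℝ) * (1 / (12 * M)) := by
        rw [mul_one_div, le_div_iff₀ (by positivity)]
        linarith
      linarith
    calc 2 * k * T * exp (-(N * (1 / (12 * M)))) ≤ 2 * k * T * exp (- Real.log (200 * k * T)) := by
          gcongr
      _ = 1 / 100 := by
          rw [Real.exp_neg, Real.exp_log (by positivity)]
          field_simp; norm_num
  · have h1 : 84 * (k * L) + 5 ≤ ε * α * n2 / 10 := by
      have h2 : 80000000 * (k * L ^ 3) ≤ ε * α * n2 := by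
        calc 80000000 * (k * L ^ 3) = ε * α * (80000000 * (L ^ 3 * ((k:ℝ) / (α * ε)))) := by field_simp
          _ ≤ _ := by gcongr
      have h3 : k * L ≤ k * L ^ 3 := by gcongr
      linarith
    calc (hbd k N M T : ℝ) * exp (-(ε * α * n2 / 10)) ≤ exp (84 * (k * L)) * exp (-(84 * (k * L) + 5)) := by
          gcongr
      _ = exp (-5) := by rw [← exp_add]; ring_nf
      _ ≤ _ := by linarith
  · have h1 : 168 * (k * L) + 6 ≤ n2 * α ^ 2 / 50 := by
      have h2 : 80000000 * (k * L ^ 3) ≤ n2 * α ^ 2 := by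
        calc 80000000 * (k * L ^ 3) = (80000000 * (L ^ 3 * ((k:ℝ) / α ^ 2))) * α ^ 2 := by field_simp
          _ ≤ _ := by gcongr
      have h3 : k * L ≤ k * L ^ 3 := by gcongr
      linarith
    calc 2 * (hbd k N M T : ℝ) ^ 2 * exp (-(n2 * α ^ 2 / 50))
        ≤ 2 * (exp (84 * (k * L))) ^ 2 * exp (-(168 * (k * L) + 6)) := by
          gcongr
      _ = 2 * exp (-6) := by
          rw [← exp_nat_mul, mul_assoc, ← exp_add]; push_cast; ring_nf
      _ ≤ _ := by linarith

lemma two_thirds_le (r : ℝ) (h : 2 / 3 ≤ r) : (2 / 3 : ℝ≥0∞) ≤ ENNReal.ofReal r := by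
  have : (2 / 3 : ℝ≥0∞) = ENNReal.ofReal (2 / 3) := by
    rw [ENNReal.ofReal_div_of_pos (by norm_num)]; norm_num
  rw [this]
  exact ENNReal.ofReal_le_ofReal h

/-- Damping a kernel: with probability `δ` run `K`, otherwise output a fixed point. -/
lemma damp {n : ℕ} {Ω : Type*} [MeasurableSpace Ω] (o : Ω) (K : Kernel (Fin n → ℝ) Ω) (hK : IsMarkovKernel K)
    (ε δ : ℝ) (hε : 0 ≤ ε) (hδ : 0 ≤ δ) (hδ1 : δ ≤ 1) :
    ∃ K' : Kernel (Fin n → ℝ) Ω, IsMarkovKernel K' ∧ IsDP K' ε δ ∧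
      ∀ (P : Measure (Fin n → ℝ)) (S : Set Ω), ENNReal.ofReal δ * (P.bind fun x => K x) S ≤
        (P.bind fun x => K' x) S := by
  let Kf : (Fin n → ℝ) → Measure Ω := fun x =>
    ENNReal.ofReal δ • K x + ENNReal.ofReal (1 - δ) • Measure.dirac o
  have hKf : Measurable Kf := by
    apply Measure.measurable_of_measurable_coe
    intro O hO
    simp only [Kf, Measure.add_apply, Measure.smul_apply, smul_eq_mul]
    exact ((K.measurable_coe hO).const_mul _).add_const _
  have h1 : 1 ≤ ENNReal.ofReal (exp ε) := by
    rw [← ENNReal.ofReal_one]; exact ENNReal.ofReal_le_ofReal (one_le_exp hε)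
  refine ⟨⟨Kf, hKf⟩, ⟨fun x => ⟨?_⟩⟩, ?_, ?_⟩
  · show Kf x Set.univ = 1
    simp only [Kf, Measure.add_apply, Measure.smul_apply, smul_eq_mul, measure_univ, mul_one]
    rw [← ENNReal.ofReal_add hδ (by linarith)]
    simp
  · intro x x' _ O _
    show Kf x' O ≤ _ * Kf x O + _
    have a1 : ENNReal.ofReal δ * K x' O ≤ ENNReal.ofReal δ := by
      calc _ ≤ ENNReal.ofReal δ * 1 := by gcongr; exact prob_le_one
        _ = _ := mul_one _
    have a2 : ENNReal.ofReal (1 - δ) * Measure.dirac o O ≤ ENNReal.ofReal (exp ε) * Kf x O := by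
      calc _ ≤ Kf x O := by
            simp only [Kf, Measure.add_apply, Measure.smul_apply, smul_eq_mul]; exact le_add_self
        _ = 1 * Kf x O := (one_mul _).symm
        _ ≤ _ := by gcongr
    calc Kf x' O = ENNReal.ofReal δ * K x' O + ENNReal.ofReal (1 - δ) * Measure.dirac o O := by
          simp only [Kf, Measure.add_apply, Measure.smul_apply, smul_eq_mul]
      _ ≤ ENNReal.ofReal δ + ENNReal.ofReal (exp ε) * Kf x O := add_le_add a1 a2
      _ = _ := add_comm _ _
  · intro P S
    have hle : ENNReal.ofReal δ • (P.bind fun x => K x) ≤ P.bind fun x => Kf x := by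
      apply Measure.le_iff.2
      intro A hA
      rw [Measure.smul_apply, Measure.bind_apply hA K.measurable.aemeasurable,
        Measure.bind_apply hA hKf.aemeasurable, smul_eq_mul, ← lintegral_const_mul _ (K.measurable_coe hA)]
      refine lintegral_mono fun x => ?_
      simp only [Kf, Measure.add_apply, Measure.smul_apply, smul_eq_mul]
      exact le_self_add
    have := hle S
    rwa [Measure.smul_apply, smul_eq_mul] at this

theorem final_aux :
    ∃ C > (0 : ℝ),
      ∀ α ε δ : ℝ, 0 < α → α < 1 → 0 < ε → ε < 1 → 0 < δ → δ < 1 →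
      ∀ k n : ℕ,
        (n : ℝ) ≥ C * Real.log (2 + (k : ℝ) / (α * ε * δ)) ^ C *
          ((k : ℝ) / α ^ 2 + (k : ℝ) * Real.log (1 / δ) / (α * ε)) →
        ∃ K : Kernel (Fin n → ℝ) ((Fin k → ℝ) × (Fin k → ℝ) × (Fin k → ℝ)),
          IsMarkovKernel K ∧ IsDP K ε δ ∧
          ∀ w μ σ : Fin k → ℝ, IsMixParams1 w σ →
            (2 / 3 : ℝ≥0∞) ≤
              ((Measure.pi fun _ : Fin n => mixture1 k w μ σ).bind fun x => K x)
                {p : (Fin k → ℝ) × (Fin k → ℝ) × (Fin k → ℝ) |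
                  IsMixParams1 p.1 p.2.2 ∧
                  TV (mixture1 k p.1 p.2.1 p.2.2) (mixture1 k w μ σ) ≤ α} := by
  obtain ⟨C, hC⟩ : ∃ C : ℝ, C = 10000000000 := ⟨_, rfl⟩
  refine ⟨C, by rw [hC]; norm_num, ?_⟩
  intro α ε δ hα hα1 hε hε1 hδ hδ1 k n hn
  rcases Nat.eq_zero_or_pos k with rfl | hk
  · obtain ⟨K, hK, hdp, -⟩ := damp (n := n) (0 : Pm 0) (Kernel.const _ (Measure.dirac (0 : Pm 0)))
      inferInstance ε δ hε.le hδ.le hδ1.le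
    refine ⟨K, hK, hdp, ?_⟩
    intro w μ σ h
    have := h.2.1
    simp at this
  have hkr : (1:ℝ) ≤ k := by exact_mod_cast hk
  set L := Real.log (2 + (k : ℝ) / (α * ε * δ)) with hL
  have hp : 0 < α * ε * δ := by positivity
  have hple : α * ε * δ ≤ α := by
    have : α * ε ≤ α := by nlinarith
    nlinarith [mul_pos hα hε]
  have hkαp : (k:ℝ) / α ≤ k / (α * ε * δ) := div_le_div_of_nonneg_left (by linarith) hp hple
  have hkα : (k:ℝ) ≤ k / α := by rw [le_div_iff₀ hα]; nlinarith
  have hL1 : 1 ≤ L := by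
    rw [hL, Real.le_log_iff_exp_le (by positivity)]
    have := Real.exp_one_lt_d9
    linarith
  have hLC : L ^ 3 ≤ L ^ C := by
    rw [← Real.rpow_natCast]
    exact Real.rpow_le_rpow_of_exponent_le hL1 (by rw [hC]; norm_num)
  have hlog : 1 - δ ≤ Real.log (1 / δ) := by
    rw [one_div, Real.log_inv]
    have := Real.log_le_sub_one_of_pos hδ
    linarith
  have hA : 0 ≤ (k:ℝ) / α ^ 2 := by positivity
  have hB : 0 ≤ (k:ℝ) / (α * ε) := by positivity
  have hBl : (k:ℝ) * Real.log (1 / δ) / (α * ε) = Real.log (1 / δ) * (k / (α * ε)) := by ring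
  have hn1 : 10000000000 * L ^ 3 * ((k : ℝ) / α ^ 2 + (1 - δ) * (k / (α * ε))) ≤ n := by
    refine le_trans ?_ hn
    rw [hBl]
    have : 0 ≤ 1 - δ := by linarith
    have hC' : (10000000000 : ℝ) ≤ C := hC.ge
    have hC0 : 0 ≤ C := le_trans (by norm_num) hC'
    have hLC0 : 0 ≤ L ^ C := Real.rpow_nonneg (by linarith) C
    have hL3' : 0 ≤ L ^ 3 := by positivity
    refine mul_le_mul (mul_le_mul hC' hLC hL3' hC0) (add_le_add le_rfl
      (mul_le_mul_of_nonneg_right hlog hB)) (add_nonneg hA (mul_nonneg this hB)) (mul_nonneg hC0 hLC0)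
  have hL30 : 0 ≤ L ^ 3 := by positivity
  by_cases hδ7 : δ < 7 / 10
  · obtain ⟨K, hK, hdp, hu⟩ := main_lemma k n hk α ε δ hα hα1 hε hε1 hδ hδ1 (by
      refine le_trans ?_ hn1
      have h3 : 3 / 10 * ((k:ℝ) / (α * ε)) ≤ (1 - δ) * (k / (α * ε)) := by gcongr; linarith
      rw [← hL, mul_comm (300000000:ℝ), mul_comm (10000000000:ℝ), mul_assoc, mul_assoc]
      apply mul_le_mul_of_nonneg_left _ hL30
      linarith)
    exact ⟨K, hK, hdp, fun w μ σ h => (two_thirds_le _ (by norm_num)).trans (hu w μ σ h)⟩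
  · push Not at hδ7
    obtain ⟨K, hK, -, hu⟩ := main_lemma k n hk α (1 / 2) (1 / 2) hα hα1 (by norm_num) (by norm_num)
      (by norm_num) (by norm_num) (by
      refine le_trans ?_ hn1
      have e1 : (k:ℝ) / (α * (1 / 2) * (1 / 2)) = 4 * (k / α) := by field_simp; norm_num
      have e2 : (k:ℝ) / (α * (1 / 2)) = 2 * (k / α) := by field_simp
      rw [e1, e2]
      have hL0 : Real.log (2 + 4 * (k / α)) ≤ 2 * L := by
        have h1 : 2 + 4 * ((k:ℝ) / α) ≤ (2 + (k : ℝ) / (α * ε * δ)) ^ 2 := by nlinarith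
        have h2 := Real.log_le_log (by positivity) h1
        rw [Real.log_pow] at h2
        exact_mod_cast h2
      have hL00 : 0 ≤ Real.log (2 + 4 * ((k:ℝ) / α)) := Real.log_nonneg (by linarith)
      have hkk : (k:ℝ) / α ≤ k / α ^ 2 := by
        apply div_le_div_of_nonneg_left (by linarith) (by positivity); nlinarith
      have hB' : 0 ≤ (1 - δ) * ((k:ℝ) / (α * ε)) := mul_nonneg (by linarith) hB
      calc 300000000 * Real.log (2 + 4 * (k / α)) ^ 3 * ((k:ℝ) / α ^ 2 + 2 * (k / α))
          ≤ 300000000 * (2 * L) ^ 3 * ((k:ℝ) / α ^ 2 + 2 * (k / α ^ 2)) := by gcongr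
        _ = L ^ 3 * (7200000000 * ((k:ℝ) / α ^ 2)) := by ring
        _ ≤ L ^ 3 * (10000000000 * ((k : ℝ) / α ^ 2 + (1 - δ) * (k / (α * ε)))) := by
            apply mul_le_mul_of_nonneg_left _ hL30
            linarith
        _ = _ := by ring)
    obtain ⟨K', hK', hdp', hle⟩ := damp (n := n) (0 : Pm k) K hK ε δ hε.le hδ.le hδ1.le
    refine ⟨K', hK', hdp', fun w μ σ h => ?_⟩
    refine le_trans ?_ (hle _ _)
    refine le_trans ?_ (mul_le_mul' le_rfl (hu w μ σ h))
    rw [← ENNReal.ofReal_mul hδ.le]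
    exact two_thirds_le _ (by linarith)

/-- Theorem 1.2: optimal sample complexity for privately learning mixtures of `k`
univariate Gaussians. -/
theorem private_univariate_GMM_learning_upper_bound :
    ∃ C > (0 : ℝ),
      ∀ α ε δ : ℝ, 0 < α → α < 1 → 0 < ε → ε < 1 → 0 < δ → δ < 1 →
      ∀ k n : ℕ,
        (n : ℝ) ≥ C * Real.log (2 + (k : ℝ) / (α * ε * δ)) ^ C *
          ((k : ℝ) / α ^ 2 + (k : ℝ) * Real.log (1 / δ) / (α * ε)) →
        ∃ K : Kernel (Fin n → ℝ) ((Fin k → ℝ) × (Fin k → ℝ) × (Fin k → ℝ)),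
          IsMarkovKernel K ∧ IsDP K ε δ ∧
          ∀ w μ σ : Fin k → ℝ, IsMixParams1 w σ →
            (2 / 3 : ℝ≥0∞) ≤
              ((Measure.pi fun _ : Fin n => mixture1 k w μ σ).bind fun x => K x)
                {p : (Fin k → ℝ) × (Fin k → ℝ) × (Fin k → ℝ) |
                  IsMixParams1 p.1 p.2.2 ∧
                  TV (mixture1 k p.1 p.2.1 p.2.2) (mixture1 k w μ σ) ≤ α} := by
  exact final_aux

end
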